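/- arXiv:1308.0519 — 3 statements merged into one kernel-verified Lean document; each statement's English description precedes it below -/
import Mathlib

section
/- Let α > 0 and 0 < μ < (2+α)²/2, and set δ^± = ( (2+α)² − μ ± (2+α)√((2+α)² − 2μ) )/μ and u_±(x) = log( 2δ^±(2+α)² / (μ(δ^± + |x|^{2+α})²) ). Then μ·∫_{B₁} |x|^α e^{u_+(x)} dx = 2π( (2+α) − √((2+α)² − 2μ) ) and μ·∫_{B₁} |x|^α e^{u_-(x)} dx = 2π( (2+α) + √((2+α)² − 2μ) ), where B₁ is the open unit ball of ℝ². -/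
open Set MeasureTheory

theorem mass_aux (α : ℝ) (hα : 0 < α) (μ : ℝ) (hμ : 0 < μ) (δ : ℝ) (hδ : 0 < δ)
    (u : EuclideanSpace ℝ (Fin 2) → ℝ)
    (hu : ∀ x, u x = Real.log (2 * δ * (2 + α) ^ 2 / (μ * (δ + ‖x‖ ^ (2 + α)) ^ 2))) :
    μ * (∫ x in Metric.ball (0 : EuclideanSpace ℝ (Fin 2)) 1, ‖x‖ ^ α * Real.exp (u x)) =
      4 * Real.pi * (2 + α) / (δ + 1) := by
  set g : ℝ → ℝ := fun r => r ^ α * (2 * δ * (2 + α) ^ 2 / (μ * (δ + r ^ (2 + α)) ^ 2)) with hg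
  have hden : ∀ r : ℝ, 0 ≤ r → 0 < δ + r ^ (2 + α) := fun r hr => by positivity
  have h1 : (∫ x in Metric.ball (0 : EuclideanSpace ℝ (Fin 2)) 1, ‖x‖ ^ α * Real.exp (u x))
      = ∫ x : EuclideanSpace ℝ (Fin 2), (Iio (1 : ℝ)).indicator g ‖x‖ := by
    rw [← integral_indicator measurableSet_ball]
    congr 1
    ext x
    have hd := hden ‖x‖ (norm_nonneg x)
    by_cases hx : ‖x‖ < 1
    · rw [indicator_of_mem (by simpa using hx), indicator_of_mem (by simpa using hx), hu,
        Real.exp_log (by positivity)]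
    · rw [indicator_of_notMem (by simpa using hx), indicator_of_notMem (by simpa using hx)]
  have hvol : (volume : Measure (EuclideanSpace ℝ (Fin 2))).real (Metric.ball 0 1) = Real.pi := by
    rw [Measure.real, EuclideanSpace.volume_ball_fin_two]
    simp [Real.pi_nonneg]
  have h2 : (∫ y in Ioi (0 : ℝ), y ^ (2 - 1) • (Iio (1 : ℝ)).indicator g y)
      = ∫ y in (0 : ℝ)..1, y * g y := by
    rw [intervalIntegral.integral_of_le zero_le_one, integral_Ioc_eq_integral_Ioo]
    have : ∀ y : ℝ, y ^ (2 - 1) • (Iio (1 : ℝ)).indicator g y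
        = (Iio (1 : ℝ)).indicator (fun y => y * g y) y := by
      intro y
      by_cases hy : y < 1
      · simp [indicator, hy]
      · simp [indicator, hy]
    simp_rw [this]
    rw [setIntegral_indicator measurableSet_Iio, Ioi_inter_Iio]
  have hcont : ContinuousOn (fun y : ℝ => y * g y) (uIcc 0 1) := by
    rw [uIcc_of_le zero_le_one]
    have ha : Continuous fun r : ℝ => r ^ α := Real.continuous_rpow_const hα.le
    have hb : Continuous fun r : ℝ => r ^ (2 + α) := Real.continuous_rpow_const (by positivity)
    refine continuousOn_id.mul (ha.continuousOn.mul (continuousOn_const.div ?_ ?_))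
    · exact (continuous_const.mul ((continuous_const.add hb).pow 2)).continuousOn
    · intro r hr
      have := hden r hr.1
      positivity
  have h3 : (∫ y in (0 : ℝ)..1, y * g y) = 2 * (2 + α) / (μ * (δ + 1)) := by
    rw [intervalIntegral.integral_eq_sub_of_hasDerivAt
      (f := fun r => - (2 * δ * (2 + α) / μ) * (δ + r ^ (2 + α))⁻¹) _ hcont.intervalIntegrable]
    · have : (0 : ℝ) ^ (2 + α) = 0 := Real.zero_rpow (by positivity)
      simp only [this, Real.one_rpow]
      field_simp
      ring
    · intro r hr
      rw [uIcc_of_le zero_le_one] at hr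
      have hd := hden r hr.1
      have e : r ^ (2 + α - 1) = r * r ^ α := by
        have : 2 + α - 1 = 1 + α := by ring
        rw [this, Real.rpow_add_of_nonneg hr.1 zero_le_one hα.le, Real.rpow_one]
      have := (((Real.hasDerivAt_rpow_const (x := r) (p := 2 + α)
        (Or.inr (by linarith))).const_add δ).inv hd.ne').const_mul (- (2 * δ * (2 + α) / μ))
      refine this.congr_deriv ?_
      rw [e, hg]
      field_simp
  rw [h1, integral_fun_norm_addHaar volume ((Iio (1 : ℝ)).indicator g), hvol]
  simp only [finrank_euclideanSpace, Fintype.card_fin]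
  rw [h2, h3]
  simp only [nsmul_eq_mul, smul_eq_mul]
  push_cast
  field_simp
  ring

/-- the total masses of the two explicit radial solutions `u₊`, `u₋`
of `−Δu = μ|x|^α e^u` in the unit ball are exactly
`2π(2+α − √((2+α)² − 2μ))` and `2π(2+α + √((2+α)² − 2μ))` respectively. -/
theorem stmt_13 (α : ℝ) (hα : 0 < α) (μ : ℝ) (hμ : 0 < μ ∧ μ < (2 + α) ^ 2 / 2)
    (δp δm : ℝ)
    (hδp : δp = ((2 + α) ^ 2 - μ + (2 + α) * Real.sqrt ((2 + α) ^ 2 - 2 * μ)) / μ)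
    (hδm : δm = ((2 + α) ^ 2 - μ - (2 + α) * Real.sqrt ((2 + α) ^ 2 - 2 * μ)) / μ)
    (up um : EuclideanSpace ℝ (Fin 2) → ℝ)
    (hup : ∀ x, up x = Real.log (2 * δp * (2 + α) ^ 2 / (μ * (δp + ‖x‖ ^ (2 + α)) ^ 2)))
    (hum : ∀ x, um x = Real.log (2 * δm * (2 + α) ^ 2 / (μ * (δm + ‖x‖ ^ (2 + α)) ^ 2))) :
    μ * (∫ x in Metric.ball (0 : EuclideanSpace ℝ (Fin 2)) 1, ‖x‖ ^ α * Real.exp (up x)) =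
      2 * Real.pi * ((2 + α) - Real.sqrt ((2 + α) ^ 2 - 2 * μ)) ∧
    μ * (∫ x in Metric.ball (0 : EuclideanSpace ℝ (Fin 2)) 1, ‖x‖ ^ α * Real.exp (um x)) =
      2 * Real.pi * ((2 + α) + Real.sqrt ((2 + α) ^ 2 - 2 * μ)) := by
  obtain ⟨h0, h1⟩ := hμ
  have hs2 : Real.sqrt ((2 + α) ^ 2 - 2 * μ) ^ 2 = (2 + α) ^ 2 - 2 * μ :=
    Real.sq_sqrt (by linarith)
  have hs0 := Real.sqrt_nonneg ((2 + α) ^ 2 - 2 * μ)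
  set s := Real.sqrt ((2 + α) ^ 2 - 2 * μ)
  have hsa : s < 2 + α := by nlinarith
  have e : μ = ((2 + α) - s) * ((2 + α) + s) / 2 := by linarith
  have hm : 0 < 2 + α - s := by linarith
  have hp : 0 < 2 + α + s := by linarith
  have ep : δp = (2 + α + s) / (2 + α - s) := by
    rw [hδp, div_eq_div_iff h0.ne' hm.ne']
    rw [e]; ring
  have em : δm = (2 + α - s) / (2 + α + s) := by
    rw [hδm, div_eq_div_iff h0.ne' hp.ne']
    rw [e]; ring
  constructor
  · rw [mass_aux α hα μ h0 δp (by rw [ep]; positivity) up hup, ep]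
    have : (2 + α + s) / (2 + α - s) + 1 = 2 * (2 + α) / (2 + α - s) := by
      field_simp; ring
    rw [this]; field_simp; ring
  · rw [mass_aux α hα μ h0 δm (by rw [em]; positivity) um hum, em]
    have : (2 + α - s) / (2 + α + s) + 1 = 2 * (2 + α) / (2 + α + s) := by
      field_simp; ring
    rw [this]; field_simp; ring
end

section
/- Let α > 0 and μ > (2+α)²/2. Then there is no C² function u on the closed unit ball of ℝ² such that u > 0 in the open unit ball B₁, u = 0 on the boundary |x| = 1, and −Δu(x) = μ·|x|^α·e^{u(x)} for all x ∈ B₁. -/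
open Set MeasureTheory

noncomputable section

/-- The Euclidean Laplacian on `ℝ²`: the sum of the two second partial derivatives. -/
def planeLaplacian (u : EuclideanSpace ℝ (Fin 2) → ℝ) (x : EuclideanSpace ℝ (Fin 2)) : ℝ :=
  ∑ i : Fin 2,
    deriv (deriv (fun t : ℝ => u (x + t • EuclideanSpace.single i (1 : ℝ)))) 0

section Aux
open Filter Topology

lemma ode_aux (β μ : ℝ) (hβ : 0 < β) (hμ : β ^ 2 / 2 < μ) (V V1 V2 : ℝ → ℝ)
    (h1 : ∀ t < 0, HasDerivAt V (V1 t) t) (h2 : ∀ t < 0, HasDerivAt V1 (V2 t) t)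
    (hi : ∀ t < 0, V2 t ≤ -(μ * Real.exp (V t + β * t)))
    (pos : ∀ t < 0, 0 < V t) (M : ℝ) (hM : ∀ᶠ t in atBot, V t ≤ M)
    (hl : Tendsto V1 atBot (𝓝 0)) : False := by
  have hμ0 : 0 < μ := lt_of_le_of_lt (by positivity) hμ
  -- antitone
  have hconv : Convex ℝ (Iio (0:ℝ)) := convex_Iio 0
  have hanti : AntitoneOn V1 (Iio 0) := by
    apply antitoneOn_of_deriv_nonpos hconv
    · intro t ht; exact (h2 t ht).continuousAt.continuousWithinAt
    · intro t ht; rw [interior_Iio] at ht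
      exact (h2 t ht).differentiableAt.differentiableWithinAt
    · intro t ht; rw [interior_Iio] at ht
      rw [(h2 t ht).deriv]
      refine (hi t ht).trans ?_
      have := Real.exp_pos (V t + β * t)
      nlinarith
  have hw : ∀ t < 0, HasDerivAt (fun t => V t + β * t) (V1 t + β) t := by
    intro t ht
    have a := (h1 t ht).fun_add ((hasDerivAt_id' t).const_mul β)
    rw [mul_one] at a
    exact a
  -- energy bound
  have key : ∀ t0 < 0, 0 ≤ V1 t0 + β → μ * Real.exp (V t0 + β * t0) ≤ β ^ 2 / 2 := by
    intro t0 ht0 hp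
    have hE : ∀ t < 0, HasDerivAt (fun t => (V1 t + β) ^ 2 / 2 + μ * Real.exp (V t + β * t))
        ((V1 t + β) * V2 t + μ * (Real.exp (V t + β * t) * (V1 t + β))) t := by
      intro t ht
      have a := ((((h2 t ht).add_const β).fun_pow 2).div_const 2).fun_add (((hw t ht).exp).const_mul μ)
      refine a.congr_deriv ?_
      push_cast; ring
    have hEa : AntitoneOn (fun t => (V1 t + β) ^ 2 / 2 + μ * Real.exp (V t + β * t)) (Iic t0) := by
      apply antitoneOn_of_deriv_nonpos (convex_Iic t0)
      · intro t ht; exact (hE t (lt_of_le_of_lt ht ht0)).continuousAt.continuousWithinAt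
      · intro t ht; rw [interior_Iic] at ht
        exact (hE t (lt_trans ht ht0)).differentiableAt.differentiableWithinAt
      · intro t ht; rw [interior_Iic] at ht
        have ht' : t < 0 := lt_trans ht ht0
        rw [(hE t ht').deriv]
        have a := hanti (a := t) (b := t0) ht' ht0 (le_of_lt ht)
        have b := hi t ht'
        nlinarith [mul_nonneg (by linarith : 0 ≤ V1 t + β) (by linarith : 0 ≤ -(V2 t + μ * Real.exp (V t + β * t)))]
    have hlim : Tendsto (fun t => (V1 t + β) ^ 2 / 2 + μ * Real.exp (V t + β * t)) atBot
        (𝓝 ((0 + β) ^ 2 / 2 + μ * 0)) := by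
      refine (((hl.add_const β).pow 2).div_const 2).add (Tendsto.const_mul μ ?_)
      apply Real.tendsto_exp_atBot.comp
      refine tendsto_atBot_mono' _ (?_ : _ ≤ᶠ[atBot] (fun t => M + β * t)) ?_
      · filter_upwards [hM] with t ht; linarith
      · exact tendsto_atBot_add_const_left _ _ (tendsto_id.const_mul_atBot hβ)
    have := ge_of_tendsto hlim (by
      filter_upwards [eventually_le_atBot t0] with t ht
      exact hEa (mem_Iic.2 ht) (mem_Iic.2 le_rfl) ht)
    simp only [zero_add, mul_zero, add_zero] at this
    nlinarith [sq_nonneg (V1 t0 + β)]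
  -- choose t1
  obtain ⟨t1, ht1, hb⟩ : ∃ t1 < 0, β ^ 2 / 2 < μ * Real.exp (β * t1) := by
    have c : ContinuousAt (fun t => μ * Real.exp (β * t)) 0 := by fun_prop
    have : ∀ᶠ t in 𝓝 (0:ℝ), β ^ 2 / 2 < μ * Real.exp (β * t) := by
      apply c.eventually (lt_mem_nhds _); simpa using hμ
    have h3 : ∀ᶠ t in 𝓝[<] (0:ℝ), β ^ 2 / 2 < μ * Real.exp (β * t) := this.filter_mono nhdsWithin_le_nhds
    obtain ⟨t, ht, ht'⟩ := (h3.and self_mem_nhdsWithin).exists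
    exact ⟨t, ht', ht⟩
  have hexp : ∀ t0 < 0, V t1 + β * t1 ≤ V t0 + β * t0 → 0 ≤ V1 t0 + β → False := by
    intro t0 ht0 hle hp
    have a := key t0 ht0 hp
    have b : Real.exp (β * t1) ≤ Real.exp (V t0 + β * t0) := by
      apply Real.exp_le_exp.2; linarith [pos t1 ht1]
    nlinarith
  by_cases hs : 0 ≤ V1 t1 + β
  · exact hexp t1 ht1 le_rfl hs
  push Not at hs
  obtain ⟨s, hs1, hs2⟩ : ∃ s < t1, 0 < V1 s + β := by
    have : ∀ᶠ t in atBot, 0 < V1 t + β :=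
      (hl.add_const β).eventually (lt_mem_nhds (by simpa using hβ))
    obtain ⟨s, a, b⟩ := (this.and (eventually_lt_atBot t1)).exists
    exact ⟨s, b, a⟩
  have hc : ContinuousOn (fun t => V1 t + β) (Icc s t1) := fun t ht =>
    ((h2 t (lt_of_le_of_lt ht.2 ht1)).add_const β).continuousAt.continuousWithinAt
  obtain ⟨t0, ⟨ht0, ht0'⟩, hz⟩ := intermediate_value_Icc' hs1.le hc ⟨hs.le, hs2.le⟩
  have ht00 : t0 < 0 := lt_of_le_of_lt ht0' ht1
  simp only at hz
  refine hexp t0 ht00 ?_ hz.ge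
  have : AntitoneOn (fun t => V t + β * t) (Icc t0 t1) := by
    apply antitoneOn_of_deriv_nonpos (convex_Icc _ _)
    · intro t ht; exact (hw t (lt_of_le_of_lt ht.2 ht1)).continuousAt.continuousWithinAt
    · intro t ht; rw [interior_Icc] at ht
      exact (hw t (lt_trans ht.2 ht1)).differentiableAt.differentiableWithinAt
    · intro t ht; rw [interior_Icc] at ht
      have ht' : t < 0 := lt_trans ht.2 ht1
      rw [(hw t ht').deriv]
      have := hanti (a := t0) (b := t) ht00 ht' ht.1.le
      linarith
  exact this (left_mem_Icc.2 ht0') (right_mem_Icc.2 ht0') ht0'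

lemma param_aux (G G' : ℝ → ℝ → ℝ)
    (hd : ∀ t < 0, ∀ θ, HasDerivAt (fun t => G t θ) (G' t θ) t)
    (hc : ∀ t < 0, Continuous (G t))
    (hc' : ContinuousOn (fun p : ℝ × ℝ => G' p.1 p.2) (Iio 0 ×ˢ univ)) (t : ℝ) (ht : t < 0) :
    HasDerivAt (fun t => ∫ θ in (0:ℝ)..(2 * Real.pi), G t θ)
      (∫ θ in (0:ℝ)..(2 * Real.pi), G' t θ) t := by
  have hsub : Icc (2 * t) (t / 2) ×ˢ Icc 0 (2 * Real.pi) ⊆ Iio 0 ×ˢ (univ : Set ℝ) := by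
    rintro ⟨a, b⟩ ⟨ha, hb⟩
    exact ⟨by have := ha.2; simp only [mem_Iio] at *; linarith, mem_univ _⟩
  obtain ⟨C, hC⟩ := (isCompact_Icc.prod isCompact_Icc).exists_bound_of_continuousOn (hc'.mono hsub)
  have hcc : ∀ s < 0, Continuous (G' s) := by
    intro s hs
    rw [← continuousOn_univ]
    exact hc'.comp (f := fun θ : ℝ => (s, θ)) (by fun_prop) (fun x _ => ⟨hs, mem_univ _⟩)
  have hnb : Ioo (2 * t) (t / 2) ∈ 𝓝 t := Ioo_mem_nhds (by linarith) (by linarith)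
  refine (intervalIntegral.hasDerivAt_integral_of_dominated_loc_of_deriv_le
    (bound := fun _ => C) hnb ?_ ?_ ?_ ?_ ?_ ?_).2
  · filter_upwards [Iio_mem_nhds ht] with s hs
    exact (hc s hs).aestronglyMeasurable
  · exact (hc t ht).intervalIntegrable _ _
  · exact (hcc t ht).aestronglyMeasurable
  · refine Eventually.of_forall fun θ hθ s hs => ?_
    rw [uIoc_of_le Real.two_pi_pos.le] at hθ
    exact hC (s, θ) ⟨⟨hs.1.le, hs.2.le⟩, ⟨hθ.1.le, hθ.2⟩⟩
  · exact intervalIntegrable_const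
  · refine Eventually.of_forall fun θ hθ s hs => hd s (by have := hs.2; linarith) θ

abbrev PE := EuclideanSpace ℝ (Fin 2)

def pp (θ : ℝ) : PE :=
  Real.cos θ • EuclideanSpace.single 0 (1 : ℝ) + Real.sin θ • EuclideanSpace.single 1 (1 : ℝ)
def qq (θ : ℝ) : PE :=
  (-Real.sin θ) • EuclideanSpace.single 0 (1 : ℝ) + Real.cos θ • EuclideanSpace.single 1 (1 : ℝ)

lemma pp_norm (θ : ℝ) : ‖pp θ‖ = 1 := by
  rw [EuclideanSpace.norm_eq, Fin.sum_univ_two]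
  simp [pp]

lemma pp_deriv (θ : ℝ) : HasDerivAt pp (qq θ) θ :=
  ((Real.hasDerivAt_cos θ).smul_const _).add ((Real.hasDerivAt_sin θ).smul_const _)

lemma qq_deriv (θ : ℝ) : HasDerivAt qq (-pp θ) θ := by
  have := ((Real.hasDerivAt_sin θ).neg.smul_const (EuclideanSpace.single 0 (1 : ℝ) : PE)).add
    ((Real.hasDerivAt_cos θ).smul_const (EuclideanSpace.single 1 (1 : ℝ) : PE))
  refine this.congr_deriv ?_
  simp only [pp, neg_smul]; abel

lemma pp_cont : Continuous pp := continuous_iff_continuousAt.2 fun θ => (pp_deriv θ).continuousAt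
lemma qq_cont : Continuous qq := continuous_iff_continuousAt.2 fun θ => (qq_deriv θ).continuousAt

lemma pt_norm (t θ : ℝ) : ‖Real.exp t • pp θ‖ = Real.exp t := by
  rw [norm_smul, pp_norm, mul_one, Real.norm_eq_abs, abs_of_pos (Real.exp_pos t)]

lemma pt_mem (t θ : ℝ) (ht : t < 0) : Real.exp t • pp θ ∈ Metric.ball (0 : PE) 1 := by
  rw [mem_ball_zero_iff, pt_norm]; rw [← Real.exp_zero]; exact Real.exp_lt_exp.2 ht

/-- The Laplacian in terms of the second Fréchet derivative. -/
lemma lap_eq (u : PE → ℝ) (D : PE → PE →L[ℝ] ℝ) (D2 : PE → PE →L[ℝ] PE →L[ℝ] ℝ)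
    (hD : ∀ x ∈ Metric.ball (0 : PE) 1, HasFDerivAt u (D x) x)
    (hD2 : ∀ x ∈ Metric.ball (0 : PE) 1, HasFDerivAt D (D2 x) x)
    (x : PE) (hx : x ∈ Metric.ball (0 : PE) 1) :
    planeLaplacian u x = ∑ i : Fin 2, D2 x (EuclideanSpace.single i 1) (EuclideanSpace.single i 1) := by
  unfold planeLaplacian
  refine Finset.sum_congr rfl fun i _ => ?_
  set v : PE := EuclideanSpace.single i 1
  have hl : ∀ t : ℝ, HasDerivAt (fun t : ℝ => x + t • v) v t := fun t => by
    simpa using ((hasDerivAt_id' t).smul_const v).const_add x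
  have hev : ∀ᶠ t : ℝ in 𝓝 0, x + t • v ∈ Metric.ball (0 : PE) 1 := by
    apply (hl 0).continuousAt.eventually
    beta_reduce
    rw [zero_smul, add_zero]
    exact Metric.isOpen_ball.mem_nhds hx
  have h1 : deriv (fun t : ℝ => u (x + t • v)) =ᶠ[𝓝 0] fun t => D (x + t • v) v := by
    filter_upwards [hev] with t ht
    exact ((hD _ ht).comp_hasDerivAt t (hl t)).deriv
  rw [h1.deriv_eq]
  have h2 : HasDerivAt (fun t : ℝ => D (x + t • v)) (D2 x v) 0 :=
    HasFDerivAt.comp_hasDerivAt 0 (by simpa using hD2 x hx) (hl 0)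
  have h3 := h2.clm_apply (hasDerivAt_const (0:ℝ) v)
  simpa using h3.deriv

lemma D2_rot (B : PE →L[ℝ] PE →L[ℝ] ℝ) (r θ : ℝ) :
    B (r • pp θ) (r • pp θ) + B (r • qq θ) (r • qq θ)
      = r ^ 2 * ∑ i : Fin 2, B (EuclideanSpace.single i 1) (EuclideanSpace.single i 1) := by
  rw [Fin.sum_univ_two]
  simp only [pp, qq, map_add, map_smul, add_apply, smul_apply,
    smul_eq_mul]
  have := Real.sin_sq_add_cos_sq θ
  have h : Real.sin θ ^ 2 = 1 - Real.cos θ ^ 2 := by linarith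
  ring_nf
  rw [h]; ring

set_option maxHeartbeats 2000000 in
lemma main_aux (α : ℝ) (hα : 0 < α) (μ : ℝ) (hμ : (2 + α) ^ 2 / 2 < μ) (u : PE → ℝ)
    (hu : ContDiffOn ℝ 2 u (Metric.ball (0 : PE) 1))
    (hpos : ∀ x ∈ Metric.ball (0 : PE) 1, 0 < u x)
    (heq : ∀ x ∈ Metric.ball (0 : PE) 1,
        -planeLaplacian u x = μ * ‖x‖ ^ α * Real.exp (u x)) : False := by
  have hμ0 : 0 < μ := lt_of_le_of_lt (by positivity) hμ
  set B : Set PE := Metric.ball (0 : PE) 1 with hB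
  have hBo : IsOpen B := Metric.isOpen_ball
  set D := fderiv ℝ u with hDdef
  set D2 := fderiv ℝ D with hD2def
  have hDc : ContDiffOn ℝ 1 D B := hu.fderiv_of_isOpen hBo (by norm_num)
  have hD2c : ContDiffOn ℝ 0 D2 B := hDc.fderiv_of_isOpen hBo (by norm_num)
  have hD : ∀ x ∈ B, HasFDerivAt u (D x) x := fun x hx =>
    ((hu.contDiffAt (hBo.mem_nhds hx)).differentiableAt (by norm_num)).hasFDerivAt
  have hD2 : ∀ x ∈ B, HasFDerivAt D (D2 x) x := fun x hx =>
    ((hDc.contDiffAt (hBo.mem_nhds hx)).differentiableAt (by norm_num)).hasFDerivAt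
  have cu : ContinuousOn u B := hu.continuousOn
  have cD : ContinuousOn D B := hDc.continuousOn
  have cD2 : ContinuousOn D2 B := hD2c.continuousOn
  let X : ℝ → ℝ → PE := fun t θ => Real.exp t • pp θ
  have hX : ∀ t < 0, ∀ θ, X t θ ∈ B := fun t ht θ => pt_mem t θ ht
  have Xt : ∀ t θ, HasDerivAt (fun t => X t θ) (X t θ) t := fun t θ =>
    (Real.hasDerivAt_exp t).smul_const _
  have Xth : ∀ t θ, HasDerivAt (fun θ => X t θ) (Real.exp t • qq θ) θ := fun t θ =>
    (pp_deriv θ).fun_const_smul (Real.exp t)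
  have Xc : Continuous (fun p : ℝ × ℝ => X p.1 p.2) :=
    (Real.continuous_exp.comp continuous_fst).smul (pp_cont.comp continuous_snd)
  have Xmaps : MapsTo (fun p : ℝ × ℝ => X p.1 p.2) (Iio 0 ×ˢ univ) B := fun p hp => hX _ hp.1 _
  have slice : ∀ F : ℝ → ℝ → ℝ, ContinuousOn (fun p : ℝ × ℝ => F p.1 p.2) (Iio 0 ×ˢ univ) →
      ∀ t < 0, Continuous (F t) := by
    intro F hF t ht
    rw [← continuousOn_univ]
    exact hF.comp (f := fun θ : ℝ => (t, θ)) (by fun_prop) (fun x _ => ⟨ht, mem_univ _⟩)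
  let U0 : ℝ → ℝ → ℝ := fun t θ => u (X t θ)
  let U1 : ℝ → ℝ → ℝ := fun t θ => D (X t θ) (X t θ)
  let U2 : ℝ → ℝ → ℝ := fun t θ => D2 (X t θ) (X t θ) (X t θ) + D (X t θ) (X t θ)
  have cU0 : ContinuousOn (fun p : ℝ × ℝ => U0 p.1 p.2) (Iio 0 ×ˢ univ) :=
    cu.comp Xc.continuousOn Xmaps
  have cDX : ContinuousOn (fun p : ℝ × ℝ => D (X p.1 p.2)) (Iio 0 ×ˢ univ) :=
    cD.comp Xc.continuousOn Xmaps
  have cD2X : ContinuousOn (fun p : ℝ × ℝ => D2 (X p.1 p.2)) (Iio 0 ×ˢ univ) :=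
    cD2.comp Xc.continuousOn Xmaps
  have cU1 : ContinuousOn (fun p : ℝ × ℝ => U1 p.1 p.2) (Iio 0 ×ˢ univ) :=
    cDX.clm_apply Xc.continuousOn
  have cU2 : ContinuousOn (fun p : ℝ × ℝ => U2 p.1 p.2) (Iio 0 ×ˢ univ) :=
    ((cD2X.clm_apply Xc.continuousOn).clm_apply Xc.continuousOn).add cU1
  have d0 : ∀ t < 0, ∀ θ, HasDerivAt (fun t => U0 t θ) (U1 t θ) t := fun t ht θ =>
    (hD _ (hX t ht θ)).comp_hasDerivAt t (Xt t θ)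
  have d1 : ∀ t < 0, ∀ θ, HasDerivAt (fun t => U1 t θ) (U2 t θ) t := fun t ht θ =>
    ((hD2 _ (hX t ht θ)).comp_hasDerivAt t (Xt t θ)).clm_apply (Xt t θ)
  -- angular derivatives
  let W1 : ℝ → ℝ → ℝ := fun t θ => D (X t θ) (Real.exp t • qq θ)
  let W2 : ℝ → ℝ → ℝ := fun t θ =>
    D2 (X t θ) (Real.exp t • qq θ) (Real.exp t • qq θ) + D (X t θ) (Real.exp t • (-pp θ))
  have Yc : Continuous (fun p : ℝ × ℝ => Real.exp p.1 • qq p.2) :=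
    (Real.continuous_exp.comp continuous_fst).smul (qq_cont.comp continuous_snd)
  have Zc : Continuous (fun p : ℝ × ℝ => Real.exp p.1 • (-pp p.2)) :=
    (Real.continuous_exp.comp continuous_fst).smul (pp_cont.comp continuous_snd).neg
  have cW2 : ContinuousOn (fun p : ℝ × ℝ => W2 p.1 p.2) (Iio 0 ×ˢ univ) :=
    ((cD2X.clm_apply Yc.continuousOn).clm_apply Yc.continuousOn).add
      (cDX.clm_apply Zc.continuousOn)
  have dW : ∀ t < 0, ∀ θ, HasDerivAt (fun θ => W1 t θ) (W2 t θ) θ := fun t ht θ =>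
    ((hD2 _ (hX t ht θ)).comp_hasDerivAt θ (Xth t θ)).clm_apply ((qq_deriv θ).fun_const_smul (Real.exp t))
  have iW : ∀ t < 0, ∫ θ in (0:ℝ)..(2 * Real.pi), W2 t θ = 0 := by
    intro t ht
    rw [intervalIntegral.integral_eq_sub_of_hasDerivAt (fun θ _ => dW t ht θ)
      ((slice W2 cW2 t ht).intervalIntegrable _ _)]
    simp [W1, X, pp, qq]
  have hsum : ∀ t < 0, ∀ θ, U2 t θ + W2 t θ = -(μ * Real.exp ((2 + α) * t) * Real.exp (U0 t θ)) := by
    intro t ht θ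
    have e := heq _ (hX t ht θ)
    rw [lap_eq u D D2 hD hD2 _ (hX t ht θ)] at e
    have r := D2_rot (D2 (X t θ)) (Real.exp t) θ
    have n : ‖X t θ‖ ^ α = Real.exp (α * t) := by
      simp only [X]
      rw [pt_norm, ← Real.exp_mul, mul_comm]
    rw [n] at e
    have ee : Real.exp ((2 + α) * t) = Real.exp t ^ 2 * Real.exp (α * t) := by
      rw [← Real.exp_nat_mul, ← Real.exp_add]; congr 1; push_cast; ring
    have s1 : U2 t θ + W2 t θ = D2 (X t θ) (Real.exp t • pp θ) (Real.exp t • pp θ)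
        + D2 (X t θ) (Real.exp t • qq θ) (Real.exp t • qq θ) := by
      simp only [U2, W2, smul_neg, map_neg, X]; ring
    rw [s1, r, ee]
    simp only [U0]
    linear_combination (-Real.exp t ^ 2) * e
  -- averages
  have hπ := Real.two_pi_pos
  let I : (ℝ → ℝ → ℝ) → ℝ → ℝ := fun F t => (2 * Real.pi)⁻¹ * ∫ θ in (0:ℝ)..(2 * Real.pi), F t θ
  have Ile : ∀ F : ℝ → ℝ → ℝ, ∀ t C, (Continuous (F t)) → (∀ θ, F t θ ≤ C) → I F t ≤ C := by
    intro F t C hF hC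
    have := intervalIntegral.integral_mono_on hπ.le (hF.intervalIntegrable 0 (2 * Real.pi))
      (intervalIntegrable_const (μ := volume) (c := C)) (fun θ _ => hC θ)
    rw [intervalIntegral.integral_const, sub_zero, smul_eq_mul] at this
    simp only [I]
    rw [inv_mul_le_iff₀ hπ]; exact this
  have Ige : ∀ F : ℝ → ℝ → ℝ, ∀ t C, (Continuous (F t)) → (∀ θ, C ≤ F t θ) → C ≤ I F t := by
    intro F t C hF hC
    have := intervalIntegral.integral_mono_on hπ.le 
      (intervalIntegrable_const (μ := volume) (c := C)) (hF.intervalIntegrable 0 (2 * Real.pi)) (fun θ _ => hC θ)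
    rw [intervalIntegral.integral_const, sub_zero, smul_eq_mul] at this
    simp only [I]
    rw [le_inv_mul_iff₀ hπ]; exact this
  have hK : Metric.closedBall (0 : PE) (1/2) ⊆ B := Metric.closedBall_subset_ball (by norm_num)
  have hXK : ∀ t ≤ Real.log (1/2), ∀ θ, X t θ ∈ Metric.closedBall (0 : PE) (1/2) := by
    intro t ht θ
    rw [mem_closedBall_zero_iff, pt_norm]
    calc Real.exp t ≤ Real.exp (Real.log (1/2)) := Real.exp_le_exp.2 ht
      _ = 1/2 := Real.exp_log (by norm_num)
  have hlog : Real.log (1/2) < 0 := Real.log_neg (by norm_num) (by norm_num)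
  obtain ⟨M, hM⟩ := (isCompact_closedBall (0 : PE) (1/2)).exists_bound_of_continuousOn (cu.mono hK)
  obtain ⟨N, hN⟩ := (isCompact_closedBall (0 : PE) (1/2)).exists_bound_of_continuousOn (cD.mono hK)
  refine ode_aux (2 + α) μ (by linarith) hμ (I U0) (I U1) (I U2) ?_ ?_ ?_ ?_ M ?_ ?_
  · intro t ht
    exact (param_aux U0 U1 d0 (slice U0 cU0) cU1 t ht).const_mul _
  · intro t ht
    exact (param_aux U1 U2 d1 (slice U1 cU1) cU2 t ht).const_mul _
  · intro t ht
    set m := I U0 t with hm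
    set c := μ * Real.exp ((2 + α) * t) * Real.exp m with hc
    have hc0 : 0 ≤ c := by positivity
    have e1 : I U2 t = I (fun t θ => U2 t θ + W2 t θ) t := by
      simp only [I]
      rw [intervalIntegral.integral_add ((slice U2 cU2 t ht).intervalIntegrable _ _)
        ((slice W2 cW2 t ht).intervalIntegrable _ _), iW t ht, add_zero]
    have e2 : I (fun t θ => U2 t θ + W2 t θ + c * (U0 t θ - m)) t = I U2 t := by
      rw [e1]
      simp only [I]
      have c0 := slice U0 cU0 t ht
      have c2 := slice U2 cU2 t ht
      have c3 := slice W2 cW2 t ht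
      rw [intervalIntegral.integral_add (Continuous.intervalIntegrable (by fun_prop) _ _)
        (Continuous.intervalIntegrable (by fun_prop) _ _), intervalIntegral.integral_const_mul,
        intervalIntegral.integral_sub (c0.intervalIntegrable _ _) intervalIntegrable_const,
        intervalIntegral.integral_const]
      have : (∫ θ in (0:ℝ)..(2 * Real.pi), U0 t θ) = 2 * Real.pi * m := by
        rw [hm]; simp only [I]; field_simp
      rw [this, smul_eq_mul]; ring
    rw [← e2]
    have e3 : -(μ * Real.exp (m + (2 + α) * t)) = -c := by
      rw [hc, Real.exp_add]; ring
    rw [e3]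
    refine Ile (fun t θ => U2 t θ + W2 t θ + c * (U0 t θ - m)) t (-c) ?_ ?_
    · exact ((slice U2 cU2 t ht).add (slice W2 cW2 t ht)).add
        (continuous_const.mul ((slice U0 cU0 t ht).sub continuous_const))
    · intro θ
      beta_reduce
      rw [hsum t ht θ]
      have j : Real.exp m * (1 + (U0 t θ - m)) ≤ Real.exp (U0 t θ) := by
        have := Real.add_one_le_exp (U0 t θ - m)
        calc _ ≤ Real.exp m * Real.exp (U0 t θ - m) := by
              gcongr; linarith
          _ = _ := by rw [← Real.exp_add]; congr 1; ring
      have := mul_le_mul_of_nonneg_left j (by positivity : 0 ≤ μ * Real.exp ((2 + α) * t))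
      rw [hc]; nlinarith
  · intro t ht
    simp only [I]
    refine mul_pos (inv_pos.2 hπ) ?_
    exact intervalIntegral.intervalIntegral_pos_of_pos_on
      ((slice U0 cU0 t ht).intervalIntegrable _ _) (fun θ _ => hpos _ (hX t ht θ)) hπ
  · filter_upwards [eventually_le_atBot (Real.log (1/2))] with t ht
    exact Ile U0 t M (slice U0 cU0 t (lt_of_le_of_lt ht hlog))
      (fun θ => (le_abs_self _).trans (hM _ (hXK t ht θ)))
  · have b : ∀ t ≤ Real.log (1/2), ∀ θ, |U1 t θ| ≤ N * Real.exp t := by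
      intro t ht θ
      have := (D (X t θ)).le_of_opNorm_le (hN _ (hXK t ht θ)) (X t θ)
      rwa [pt_norm] at this
    have z : Tendsto (fun t => N * Real.exp t) atBot (𝓝 0) := by
      simpa using Real.tendsto_exp_atBot.const_mul N
    apply squeeze_zero_norm' _ z
    filter_upwards [eventually_le_atBot (Real.log (1/2))] with t ht
    rw [Real.norm_eq_abs, abs_le]
    have cc := slice U1 cU1 t (lt_of_le_of_lt ht hlog)
    exact ⟨Ige U1 t _ cc fun θ => (abs_le.1 (b t ht θ)).1,
      Ile U1 t _ cc fun θ => (abs_le.1 (b t ht θ)).2⟩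

end Aux

/-- nonexistence beyond the extremal parameter: for `μ > (2+α)²/2` there is
no positive `C²` solution of `−Δu = μ|x|^α e^u` in the unit ball with zero boundary data. -/
theorem stmt_14 (α : ℝ) (hα : 0 < α) (μ : ℝ) (hμ : (2 + α) ^ 2 / 2 < μ) :
    ¬ ∃ u : EuclideanSpace ℝ (Fin 2) → ℝ,
      ContDiffOn ℝ 2 u (Metric.closedBall (0 : EuclideanSpace ℝ (Fin 2)) 1) ∧
      (∀ x ∈ Metric.ball (0 : EuclideanSpace ℝ (Fin 2)) 1, 0 < u x) ∧
      (∀ x : EuclideanSpace ℝ (Fin 2), ‖x‖ = 1 → u x = 0) ∧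
      (∀ x ∈ Metric.ball (0 : EuclideanSpace ℝ (Fin 2)) 1,
        -planeLaplacian u x = μ * ‖x‖ ^ α * Real.exp (u x)) := by
  rintro ⟨u, hu, hpos, -, heq⟩
  exact main_aux α hα μ hμ u (hu.mono Metric.ball_subset_closedBall) hpos heq

end
end

section
/- Let α > 0 be such that α is not an even integer (i.e. α ≠ 2(k−1) for every integer k ≥ 1). Suppose v : ℝ² → ℝ is a C² function satisfying Δv(x) + 2(α+2)²·(|x|^α/(1 + |x|^{2+α})²)·v(x) = 0 for all x ∈ ℝ² and ∫_{ℝ²} |∇v(x)|² dx < ∞. Then there exists a constant c ∈ ℝ such that v(x) = c·(1 − |x|^{2+α})/(1 + |x|^{2+α}) for all x ∈ ℝ². Conversely, this function is a C² finite-Dirichlet-energy solution for every c. -/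
open Set MeasureTheory

noncomputable section

/-! ### The converse part -/

lemma aux_hasFDerivAt_norm_rpow {x : (EuclideanSpace ℝ (Fin 2))} (hx : x ≠ 0) (p : ℝ) :
    HasFDerivAt (fun x : (EuclideanSpace ℝ (Fin 2)) ↦ ‖x‖ ^ p) ((p * ‖x‖ ^ (p - 2)) • innerSL ℝ x) x := by
  apply HasStrictFDerivAt.hasFDerivAt
  convert! (hasStrictFDerivAt_norm_sq x).rpow_const (p := p / 2) (by simp [hx]) using 0
  simp_rw [← Real.rpow_natCast_mul (norm_nonneg _), ← Nat.cast_smul_eq_nsmul ℝ, smul_smul]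
  ring_nf

/-- The field `‖x‖^α x`. -/
def auxQ (α : ℝ) (x : (EuclideanSpace ℝ (Fin 2))) : (EuclideanSpace ℝ (Fin 2)) := ‖x‖ ^ α • x

/-- The derivative of `‖x‖^α x`. -/
def auxD (α : ℝ) (x : (EuclideanSpace ℝ (Fin 2))) : (EuclideanSpace ℝ (Fin 2)) →L[ℝ] (EuclideanSpace ℝ (Fin 2)) :=
  ‖x‖ ^ α • ContinuousLinearMap.id ℝ (EuclideanSpace ℝ (Fin 2)) + (α * ‖x‖ ^ (α - 2)) • (innerSL ℝ x).smulRight x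

lemma auxD_zero {α : ℝ} (hα : 0 < α) : auxD α 0 = 0 := by
  ext1 y
  simp [auxD, Real.zero_rpow hα.ne']

lemma rpow_sub_two_mul {α : ℝ} (hα : 0 < α) {r : ℝ} (hr : 0 ≤ r) :
    r ^ (α - 2) * r ^ 2 = r ^ α := by
  rcases hr.eq_or_lt with h | h
  · subst h
    simp [Real.zero_rpow hα.ne']
  · rw [← Real.rpow_natCast r 2, ← Real.rpow_add h]
    norm_num

lemma auxD_norm {α : ℝ} (hα : 0 < α) (x : (EuclideanSpace ℝ (Fin 2))) : ‖auxD α x‖ ≤ (1 + α) * ‖x‖ ^ α := by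
  have h0 : 0 ≤ ‖x‖ ^ α := by positivity
  refine (norm_add_le _ _).trans ?_
  rw [norm_smul, norm_smul, ContinuousLinearMap.norm_smulRight_apply, innerSL_apply_norm]
  have h1 : ‖ContinuousLinearMap.id ℝ (EuclideanSpace ℝ (Fin 2))‖ ≤ 1 := ContinuousLinearMap.norm_id_le
  have h2 := rpow_sub_two_mul hα (norm_nonneg x)
  have h3 : 0 ≤ α * ‖x‖ ^ (α - 2) := by positivity
  rw [Real.norm_of_nonneg h0, Real.norm_of_nonneg h3]
  calc _ ≤ ‖x‖ ^ α * 1 + α * ‖x‖ ^ (α - 2) * (‖x‖ * ‖x‖) := by gcongr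
    _ = ‖x‖ ^ α * 1 + α * (‖x‖ ^ (α - 2) * ‖x‖ ^ 2) := by ring
    _ = _ := by rw [h2]; ring

lemma tendsto_norm_rpow_zero {α : ℝ} (hα : 0 < α) :
    Filter.Tendsto (fun x : (EuclideanSpace ℝ (Fin 2)) => ‖x‖ ^ α) (nhds 0) (nhds 0) := by
  have : Continuous (fun x : (EuclideanSpace ℝ (Fin 2)) => ‖x‖ ^ α) := continuous_norm.rpow_const (fun _ => Or.inr hα.le)
  simpa [Real.zero_rpow hα.ne'] using this.tendsto 0

lemma auxQ_hasFDerivAt {α : ℝ} (hα : 0 < α) (x : (EuclideanSpace ℝ (Fin 2))) :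
    HasFDerivAt (auxQ α) (auxD α x) x := by
  by_cases hx : x = 0
  · subst hx
    rw [auxD_zero hα]
    refine .of_isLittleO ?_
    have : (fun x : (EuclideanSpace ℝ (Fin 2)) => ‖x‖ ^ α • x) =o[nhds 0] (fun x : (EuclideanSpace ℝ (Fin 2)) => (1 : ℝ) • x) := by
      refine Asymptotics.IsLittleO.smul_isBigO ?_ (Asymptotics.isBigO_refl _ _)
      exact (Asymptotics.isLittleO_one_iff ℝ).2 (tendsto_norm_rpow_zero hα)
    simpa [auxQ] using this
  · have := (aux_hasFDerivAt_norm_rpow hx α).smul (hasFDerivAt_id x)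
    refine this.congr_fderiv ?_
    ext1 y
    simp [auxD, smul_smul]

lemma auxD_continuous {α : ℝ} (hα : 0 < α) : Continuous (auxD α) := by
  rw [continuous_iff_continuousAt]
  intro x
  by_cases hx : x = 0
  · subst hx
    rw [ContinuousAt, auxD_zero hα, tendsto_zero_iff_norm_tendsto_zero]
    refine squeeze_zero (fun _ => norm_nonneg _) (fun y => auxD_norm hα y) ?_
    simpa using (tendsto_norm_rpow_zero hα).const_mul (1 + α)
  · have h1 : ContinuousAt (fun y : (EuclideanSpace ℝ (Fin 2)) => ‖y‖ ^ α) x :=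
      continuous_norm.continuousAt.rpow_const (Or.inl (by simpa using hx))
    have h2 : ContinuousAt (fun y : (EuclideanSpace ℝ (Fin 2)) => ‖y‖ ^ (α - 2)) x :=
      continuous_norm.continuousAt.rpow_const (Or.inl (by simpa using hx))
    have h3 : Continuous (fun y : (EuclideanSpace ℝ (Fin 2)) => (innerSL ℝ y).smulRight y) := by
      have h4 : Continuous (fun y : (EuclideanSpace ℝ (Fin 2)) => innerSL ℝ y) := (innerSL ℝ (E := (EuclideanSpace ℝ (Fin 2)))).continuous
      exact ((ContinuousLinearMap.smulRightL ℝ (EuclideanSpace ℝ (Fin 2)) (EuclideanSpace ℝ (Fin 2))).continuous.comp h4).clm_apply continuous_id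
    exact (h1.smul continuousAt_const).add ((h2.const_mul α).smul h3.continuousAt)

lemma auxQ_contDiff {α : ℝ} (hα : 0 < α) : ContDiff ℝ 1 (auxQ α) :=
  contDiff_one_iff_hasFDerivAt.2 ⟨auxD α, auxD_continuous hα, auxQ_hasFDerivAt hα⟩

lemma auxg_hasFDerivAt {α : ℝ} (hα : 0 < α) (x : (EuclideanSpace ℝ (Fin 2))) :
    HasFDerivAt (fun x : (EuclideanSpace ℝ (Fin 2)) => ‖x‖ ^ (2 + α)) ((2 + α) • innerSL ℝ (auxQ α x)) x := by
  refine (hasFDerivAt_norm_rpow x (p := 2 + α) (by linarith)).congr_fderiv ?_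
  ext1 y
  simp only [auxQ, smul_apply, innerSL_apply_apply, inner_smul_left, smul_eq_mul]
  simp
  ring

lemma auxg_contDiff {α : ℝ} (hα : 0 < α) : ContDiff ℝ 2 (fun x : (EuclideanSpace ℝ (Fin 2)) => ‖x‖ ^ (2 + α)) := by
  have : (2 : WithTop ℕ∞) = ((1 : ℕ) : WithTop ℕ∞) + 1 := by norm_num
  rw [this]
  refine contDiff_succ_iff_hasFDerivAt.2 ⟨_, ?_, auxg_hasFDerivAt hα⟩
  exact (contDiff_const (c := (2 + α : ℝ))).smul ((innerSL ℝ (E := (EuclideanSpace ℝ (Fin 2)))).contDiff.comp (auxQ_contDiff hα))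

lemma auxphi_contDiff {α : ℝ} (hα : 0 < α) (c : ℝ) :
    ContDiff ℝ 2 (fun x : (EuclideanSpace ℝ (Fin 2)) => c * (1 - ‖x‖ ^ (2 + α)) / (1 + ‖x‖ ^ (2 + α))) := by
  have h := auxg_contDiff hα
  refine (contDiff_const.mul (contDiff_const.sub h)).div (contDiff_const.add h) ?_
  intro x
  positivity

lemma auxphi_hasFDerivAt {α : ℝ} (hα : 0 < α) (c : ℝ) (x : (EuclideanSpace ℝ (Fin 2))) :
    HasFDerivAt (fun x : (EuclideanSpace ℝ (Fin 2)) => c * (1 - ‖x‖ ^ (2 + α)) / (1 + ‖x‖ ^ (2 + α)))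
      ((-(2 * c * (2 + α)) / (1 + ‖x‖ ^ (2 + α)) ^ 2) • innerSL ℝ (auxQ α x)) x := by
  have h := auxg_hasFDerivAt hα x
  have h0 : (1 + ‖x‖ ^ (2 + α)) ≠ 0 := by positivity
  have h1 : HasDerivAt (fun g : ℝ => c * (1 - g) / (1 + g)) (-(2 * c) / (1 + ‖x‖ ^ (2 + α)) ^ 2)
      (‖x‖ ^ (2 + α)) := by
    have := (((hasDerivAt_id (‖x‖ ^ (2 + α))).const_sub 1).const_mul c).div
      ((hasDerivAt_id (‖x‖ ^ (2 + α))).const_add 1) h0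
    refine this.congr_deriv ?_
    simp only [id]
    congr 1
    ring
  have := h1.comp_hasFDerivAt x h
  refine this.congr_fderiv ?_
  rw [smul_smul]
  congr 1
  ring

lemma auxphi_integrable {α : ℝ} (hα : 0 < α) (c : ℝ) :
    Integrable (fun x : (EuclideanSpace ℝ (Fin 2)) =>
        ‖fderiv ℝ (fun y : (EuclideanSpace ℝ (Fin 2)) => c * (1 - ‖y‖ ^ (2 + α)) / (1 + ‖y‖ ^ (2 + α))) x‖ ^ 2) := by
  have hm : Continuous (fun x : (EuclideanSpace ℝ (Fin 2)) =>
        ‖fderiv ℝ (fun y : (EuclideanSpace ℝ (Fin 2)) => c * (1 - ‖y‖ ^ (2 + α)) / (1 + ‖y‖ ^ (2 + α))) x‖ ^ 2) :=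
    (((auxphi_contDiff hα c).continuous_fderiv (by norm_num)).norm).pow 2
  have hI : Integrable (fun x : (EuclideanSpace ℝ (Fin 2)) => (4 * |2 * c * (2 + α)|) ^ 2 * (1 + ‖x‖) ^ (-(4 : ℝ))) :=
    (integrable_one_add_norm (by simp; norm_num)).const_mul _
  refine hI.mono' hm.aestronglyMeasurable (Filter.Eventually.of_forall fun x => ?_)
  rw [(auxphi_hasFDerivAt hα c x).fderiv, Real.norm_of_nonneg (by positivity), norm_smul,
    innerSL_apply_norm, auxQ, norm_smul, Real.rpow_neg (by positivity)]
  have hr := norm_nonneg x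
  set r := ‖x‖
  rw [Real.norm_of_nonneg (by positivity : 0 ≤ r ^ α), norm_div, norm_neg,
    Real.norm_eq_abs (2 * c * (2 + α)), Real.norm_of_nonneg (by positivity : 0 ≤ (1 + r ^ (2 + α)) ^ 2)]
  have e1 : r ^ α * r = r ^ (α + 1) := by
    rw [Real.rpow_add_one' hr (by linarith)]
  have e2 : r ^ (α + 1) ≤ 1 + r ^ (2 + α) := by
    rcases le_total r 1 with h | h
    · have := Real.rpow_le_one hr h (by linarith : 0 ≤ α + 1)
      have : 0 ≤ r ^ (2 + α) := by positivity
      linarith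
    · have := Real.rpow_le_rpow_of_exponent_le h (by linarith : α + 1 ≤ 2 + α)
      linarith
  have e3 : (1 + r) ^ 2 ≤ 4 * (1 + r ^ (2 + α)) := by
    rcases le_total r 1 with h | h
    · have : 0 ≤ r ^ (2 + α) := by positivity
      nlinarith
    · have := Real.rpow_le_rpow_of_exponent_le h (by linarith : (2 : ℝ) ≤ 2 + α)
      rw [Real.rpow_two] at this
      nlinarith
  have e4 : (1 + r) ^ (4 : ℝ) = ((1 + r) ^ 2) ^ 2 := by
    rw [← pow_mul, ← Real.rpow_natCast]; norm_num
  rw [e1, e4, ← inv_pow, ← mul_pow]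
  have hG : 0 < 1 + r ^ (2 + α) := by positivity
  set G := 1 + r ^ (2 + α)
  refine pow_le_pow_left₀ (by positivity) ?_ 2
  calc _ ≤ |2 * c * (2 + α)| / G ^ 2 * G := by gcongr
    _ = |2 * c * (2 + α)| * G⁻¹ := by field_simp
    _ ≤ |2 * c * (2 + α)| * (4 * ((1 + r) ^ 2)⁻¹) := by
        gcongr
        rw [inv_le_comm₀ hG (by positivity), mul_inv, inv_inv]
        linarith
    _ = _ := by ring

lemma deriv_line_of_contDiff {u : (EuclideanSpace ℝ (Fin 2)) → ℝ} {u' : (EuclideanSpace ℝ (Fin 2)) → (EuclideanSpace ℝ (Fin 2)) →L[ℝ] ℝ}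
    (hu : ∀ x, HasFDerivAt u (u' x) x) (x e : (EuclideanSpace ℝ (Fin 2))) :
    deriv (fun t : ℝ => u (x + t • e)) = fun t => u' (x + t • e) e := by
  funext t
  have h : HasDerivAt (fun t : ℝ => x + t • e) e t := by
    simpa using ((hasDerivAt_id t).smul_const e).const_add x
  exact ((hu _).comp_hasDerivAt t h).deriv

lemma auxphi_second {α : ℝ} (hα : 0 < α) (c : ℝ) (x e : (EuclideanSpace ℝ (Fin 2))) :
    deriv (deriv (fun t : ℝ =>
      (fun y : (EuclideanSpace ℝ (Fin 2)) => c * (1 - ‖y‖ ^ (2 + α)) / (1 + ‖y‖ ^ (2 + α))) (x + t • e))) 0 =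
    (-(2 * c * (2 + α)) / (1 + ‖x‖ ^ (2 + α)) ^ 2) *
      (‖x‖ ^ α * inner ℝ e e + α * ‖x‖ ^ (α - 2) * (inner ℝ x e) ^ 2) +
    (4 * c * (2 + α) ^ 2 / (1 + ‖x‖ ^ (2 + α)) ^ 3) * (‖x‖ ^ α * inner ℝ x e) ^ 2 := by
  rw [deriv_line_of_contDiff (auxphi_hasFDerivAt hα c)]
  have h : HasDerivAt (fun t : ℝ => x + t • e) e 0 := by
    simpa using ((hasDerivAt_id (0 : ℝ)).smul_const e).const_add x
  have hx : x + (0 : ℝ) • e = x := by simp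
  have hg : HasDerivAt (fun t : ℝ => ‖x + t • e‖ ^ (2 + α))
      ((2 + α) * (‖x‖ ^ α * inner ℝ x e)) 0 := by
    have := (auxg_hasFDerivAt hα (x + (0 : ℝ) • e)).comp_hasDerivAt 0 h
    rw [hx] at this
    refine this.congr_deriv ?_
    simp [auxQ]
  have hQ : HasDerivAt (fun t : ℝ => inner ℝ (auxQ α (x + t • e)) e)
      (‖x‖ ^ α * inner ℝ e e + α * ‖x‖ ^ (α - 2) * (inner ℝ x e) ^ 2) 0 := by
    have := (auxQ_hasFDerivAt hα (x + (0 : ℝ) • e)).comp_hasDerivAt 0 h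
    rw [hx] at this
    have := this.inner ℝ (hasDerivAt_const 0 e)
    refine this.congr_deriv ?_
    simp [auxD, inner_add_left, inner_smul_left]
    left
    ring
  have h0 : (1 + ‖x‖ ^ (2 + α)) ≠ 0 := by positivity
  have h1 : HasDerivAt (fun g : ℝ => -(2 * c * (2 + α)) / (1 + g) ^ 2)
      (4 * c * (2 + α) / (1 + ‖x‖ ^ (2 + α)) ^ 3) (‖x‖ ^ (2 + α)) := by
    have := (hasDerivAt_const (‖x‖ ^ (2 + α)) (-(2 * c * (2 + α)))).div
      (((hasDerivAt_id (‖x‖ ^ (2 + α))).const_add 1).pow 2) (by simpa using pow_ne_zero 2 h0)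
    refine this.congr_deriv ?_
    simp only [id]
    simp
    field_simp
    ring
  have h1' : HasDerivAt (fun g : ℝ => -(2 * c * (2 + α)) / (1 + g) ^ 2)
      (4 * c * (2 + α) / (1 + ‖x‖ ^ (2 + α)) ^ 3) (‖x + (0 : ℝ) • e‖ ^ (2 + α)) := by
    rw [hx]; exact h1
  have h2 := (HasDerivAt.comp (0 : ℝ) h1' hg).mul hQ
  have h3 := h2.deriv
  refine Eq.trans ?_ (h3.trans ?_)
  · rfl
  · simp [auxQ, inner_smul_left]
    ring

lemma auxphi_laplacian {α : ℝ} (hα : 0 < α) (c : ℝ) (x : (EuclideanSpace ℝ (Fin 2))) :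
    planeLaplacian (fun y : (EuclideanSpace ℝ (Fin 2)) => c * (1 - ‖y‖ ^ (2 + α)) / (1 + ‖y‖ ^ (2 + α))) x
          + 2 * (α + 2) ^ 2 * (‖x‖ ^ α / (1 + ‖x‖ ^ (2 + α)) ^ 2) *
            (c * (1 - ‖x‖ ^ (2 + α)) / (1 + ‖x‖ ^ (2 + α))) = 0 := by
  unfold planeLaplacian
  rw [Fin.sum_univ_two]
  erw [auxphi_second hα, auxphi_second hα]
  have hn : x 0 ^ 2 + x 1 ^ 2 = ‖x‖ ^ 2 := by
    rw [EuclideanSpace.norm_sq_eq]; simp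
  have h2 := rpow_sub_two_mul hα (norm_nonneg x)
  have h3 : ‖x‖ ^ (2 + α) = ‖x‖ ^ α * ‖x‖ ^ 2 := by
    rw [Real.rpow_add' (norm_nonneg x) (by linarith), Real.rpow_two]; ring
  have h0 : (1 + ‖x‖ ^ (2 + α)) ≠ 0 := by positivity
  simp only [EuclideanSpace.inner_single_right]
  simp
  set g := ‖x‖ ^ (2 + α)
  set A := ‖x‖ ^ α
  set B := ‖x‖ ^ (α - 2)
  set r := ‖x‖
  field_simp
  have e0 : x 0 ^ 2 = r ^ 2 - x 1 ^ 2 := by linarith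
  have e1 : B * r ^ 2 = A := h2
  have hmain : A + α * B * x 0 ^ 2 + (A + α * B * x 1 ^ 2) = A * (2 + α) := by
    rw [e0]; linear_combination α * e1
  have hmain2 : A ^ 2 * x 0 ^ 2 + A ^ 2 * x 1 ^ 2 = A * g := by
    rw [e0, h3]; ring
  linear_combination (-(2 * c * (2 + α)) * (1 + g)) * hmain + 4 * c * (2 + α) ^ 2 * hmain2

/-! ### The radial ODE -/

/-- `tanh (p s / 2)`. -/
def auxT (p s : ℝ) : ℝ := (Real.exp (p * s) - 1) / (Real.exp (p * s) + 1)

lemma auxT_hasDerivAt (p s : ℝ) : HasDerivAt (auxT p) (p / 2 * (1 - auxT p s ^ 2)) s := by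
  have h : HasDerivAt (fun s => Real.exp (p * s)) (Real.exp (p * s) * p) s := by
    simpa using ((hasDerivAt_id s).const_mul p).exp
  have h0 : Real.exp (p * s) + 1 ≠ 0 := by positivity
  have := (h.sub_const 1).div (h.add_const 1) h0
  refine this.congr_deriv ?_
  unfold auxT
  field_simp
  ring

lemma auxT_abs (p s : ℝ) : |auxT p s| ≤ 1 := by
  have h := Real.exp_pos (p * s)
  unfold auxT
  rw [abs_div, abs_of_pos (by linarith : 0 < Real.exp (p * s) + 1), div_le_one (by linarith), abs_le]
  constructor <;> linarith

lemma auxT_tendsto {p : ℝ} (hp : 0 < p) : Filter.Tendsto (auxT p) Filter.atTop (nhds 1) := by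
  have h1 : Filter.Tendsto (fun s => Real.exp (p * s) + 1) Filter.atTop Filter.atTop :=
    Filter.tendsto_atTop_add_const_right _ _
      (Real.tendsto_exp_atTop.comp (Filter.tendsto_id.const_mul_atTop hp))
  have h2 : Filter.Tendsto (fun s => 1 - 2 * (Real.exp (p * s) + 1)⁻¹) Filter.atTop (nhds 1) := by
    simpa using (h1.inv_tendsto_atTop.const_mul 2).const_sub 1
  refine h2.congr fun s => ?_
  have h0 : Real.exp (p * s) + 1 ≠ 0 := by positivity
  unfold auxT
  field_simp
  ring

lemma ode_main {p n M : ℝ} (hn : 0 ≤ n) {P P' P'' : ℝ → ℝ}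
    (h1 : ∀ s, HasDerivAt P (P' s) s) (h2 : ∀ s, HasDerivAt P' (P'' s) s)
    (heq : ∀ s, P'' s = n ^ 2 * P s - 2 * (p / 2) ^ 2 * (1 - auxT p s ^ 2) * P s)
    (hb : ∀ s ≤ 0, |P s| ≤ M) (hb' : ∀ s ≤ 0, |P' s| ≤ M) :
    ∃ q : ℝ, ∀ s, ((p / 2) ^ 2 - n ^ 2) * P s = q * (p / 2 * auxT p s - n) * Real.exp (n * s) := by
  set b := p / 2 with hbdef
  set w : ℝ → ℝ := fun s => P' s + b * auxT p s * P s with hw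
  set w' : ℝ → ℝ := fun s => b * auxT p s * w s - (b ^ 2 - n ^ 2) * P s with hw'
  have hwd : ∀ s, HasDerivAt w (w' s) s := by
    intro s
    have := (h2 s).add (((auxT_hasDerivAt p s).const_mul b).mul (h1 s))
    refine this.congr_deriv ?_
    simp only [hw', hw, heq]
    ring
  have hwd' : ∀ s, HasDerivAt w' (n ^ 2 * w s) s := by
    intro s
    have := (((auxT_hasDerivAt p s).const_mul b).mul (hwd s)).sub ((h1 s).const_mul (b ^ 2 - n ^ 2))
    refine this.congr_deriv ?_
    simp only [hw', hw]
    ring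
  have hM : 0 ≤ M := (abs_nonneg _).trans (hb 0 le_rfl)
  have hwb : ∀ s ≤ 0, |w s| ≤ M + |b| * M := by
    intro s hs
    simp only [hw]
    refine (abs_add_le _ _).trans ?_
    rw [abs_mul, abs_mul]
    have := auxT_abs p s
    have h3 := hb s hs
    have h4 := hb' s hs
    calc _ ≤ M + |b| * 1 * M := by gcongr
      _ = _ := by ring
  have hexp : ∀ k s : ℝ, HasDerivAt (fun s => Real.exp (k * s)) (Real.exp (k * s) * k) s := by
    intro k s
    simpa using ((hasDerivAt_id s).const_mul k).exp
  obtain ⟨K, hK⟩ : ∃ K, ∀ s, w' s - n * w s = K * Real.exp (-n * s) := by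
    refine ⟨w' 0 - n * w 0, fun s => ?_⟩
    have hd : ∀ s, HasDerivAt (fun s => (w' s - n * w s) * Real.exp (n * s)) 0 s := by
      intro s
      have := ((hwd' s).sub ((hwd s).const_mul n)).mul (hexp n s)
      refine this.congr_deriv ?_
      simp only [Pi.sub_apply]
      ring
    have := is_const_of_deriv_eq_zero (fun s => (hd s).differentiableAt) (fun s => (hd s).deriv) s 0
    simp only [mul_zero, Real.exp_zero, mul_one] at this
    rw [← this, mul_assoc, ← Real.exp_add]
    simp
  have hK0 : K = 0 := by
    by_contra hne
    rcases hn.eq_or_lt with h0 | h0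
    · subst h0
      have hd : ∀ s, HasDerivAt (fun s => w s - K * s) 0 s := by
        intro s
        have := (hwd s).sub ((hasDerivAt_id s).const_mul K)
        refine this.congr_deriv ?_
        have := hK s
        simp at this
        simp [this]
      have hc := fun s => is_const_of_deriv_eq_zero (fun s => (hd s).differentiableAt)
        (fun s => (hd s).deriv) s 0
      set B := M + |b| * M with hB
      have hB0 : 0 ≤ B := by positivity
      have e1 := hc (-((2 * B + 1) / |K|))
      have hKp : 0 < |K| := abs_pos.2 hne
      have e2 := hwb (-((2 * B + 1) / |K|)) (by rw [neg_nonpos]; positivity)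
      have e3 := hwb 0 le_rfl
      have e4 : K * (-((2 * B + 1) / |K|)) = w (-((2 * B + 1) / |K|)) - w 0 := by
        simp only [mul_zero, sub_zero] at e1
        linarith
      have e5 : |K * (-((2 * B + 1) / |K|))| = 2 * B + 1 := by
        rw [abs_mul, abs_neg, abs_of_nonneg (by positivity : 0 ≤ (2 * B + 1) / |K|)]
        field_simp
      rw [e4] at e5
      have := abs_sub (w (-((2 * B + 1) / |K|))) (w 0)
      linarith
    · have hbd : ∀ s ≤ 0, |K| * Real.exp (-n * s) ≤
          (|b| * (M + |b| * M) + |b ^ 2 - n ^ 2| * M) + n * (M + |b| * M) := by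
        intro s hs
        have e1 : |K| * Real.exp (-n * s) = |w' s - n * w s| := by
          rw [hK s, abs_mul, abs_of_pos (Real.exp_pos _)]
        rw [e1]
        have e2 := hwb s hs
        have e3 := hb s hs
        have e4 := auxT_abs p s
        refine (abs_sub _ _).trans ?_
        rw [abs_mul n, abs_of_pos h0]
        have e5 : |w' s| ≤ |b| * 1 * (M + |b| * M) + |b ^ 2 - n ^ 2| * M := by
          simp only [hw']
          refine (abs_sub _ _).trans ?_
          rw [abs_mul, abs_mul, abs_mul]
          gcongr
        have e6 : n * |w s| ≤ n * (M + |b| * M) := by gcongr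
        linarith
      set C := (|b| * (M + |b| * M) + |b ^ 2 - n ^ 2| * M) + n * (M + |b| * M) with hC
      have hC0 : 0 ≤ C := by positivity
      have hKp : 0 < |K| := abs_pos.2 hne
      have e1 := hbd (-(C / |K| / n)) (by rw [neg_nonpos]; positivity)
      have e2 : -n * (-(C / |K| / n)) = C / |K| := by field_simp
      rw [e2] at e1
      have e3 := Real.add_one_le_exp (C / |K|)
      have : |K| * (C / |K| + 1) ≤ C := (mul_le_mul_of_nonneg_left e3 hKp.le).trans e1
      have e4 : |K| * (C / |K| + 1) = C + |K| := by field_simp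
      linarith
  have hfin : ∀ s, w' s = n * w s := fun s => by
    have := hK s
    rw [hK0] at this
    linarith
  refine ⟨w 0, fun s => ?_⟩
  have hd : ∀ s, HasDerivAt (fun s => w s * Real.exp (-n * s)) 0 s := by
    intro s
    have := (hwd s).mul (hexp (-n) s)
    refine this.congr_deriv ?_
    rw [hfin]
    ring
  have := is_const_of_deriv_eq_zero (fun s => (hd s).differentiableAt) (fun s => (hd s).deriv) s 0
  simp only [mul_zero, Real.exp_zero, mul_one] at this
  have hws : w s = w 0 * Real.exp (n * s) := by
    rw [← this, mul_assoc, ← Real.exp_add]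
    simp
  have h5 := hfin s
  simp only [hw'] at h5
  have h6 : (b ^ 2 - n ^ 2) * P s = (b * auxT p s - n) * w s := by linarith
  rw [h6, hws]
  ring

lemma param_deriv {G G' : ℝ → ℝ → ℝ} (hG : Continuous (Function.uncurry G))
    (hG' : Continuous (Function.uncurry G'))
    (hd : ∀ s θ, HasDerivAt (fun s => G s θ) (G' s θ) s) (s : ℝ) :
    HasDerivAt (fun s => ∫ θ in (-Real.pi)..Real.pi, G s θ)
      (∫ θ in (-Real.pi)..Real.pi, G' s θ) s := by
  have hK : IsCompact (Metric.closedBall s 1 ×ˢ Icc (-Real.pi) Real.pi) :=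
    (isCompact_closedBall s 1).prod isCompact_Icc
  obtain ⟨C, hC⟩ := hK.exists_bound_of_continuousOn hG'.continuousOn
  have c1 : ∀ s, Continuous (G s) := fun s => hG.comp (by fun_prop : Continuous fun θ : ℝ => (s, θ))
  have c2 : ∀ s, Continuous (G' s) := fun s => hG'.comp (by fun_prop : Continuous fun θ : ℝ => (s, θ))
  refine (intervalIntegral.hasDerivAt_integral_of_dominated_loc_of_deriv_le
    (bound := fun _ => C) (Metric.closedBall_mem_nhds s one_pos)
    (Filter.Eventually.of_forall fun s => (c1 s).aestronglyMeasurable)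
    ((c1 s).intervalIntegrable _ _) (c2 s).aestronglyMeasurable ?_ intervalIntegrable_const ?_).2
  · refine Filter.Eventually.of_forall fun θ hθ x hx => ?_
    rw [uIoc_of_le (by linarith [Real.pi_pos])] at hθ
    exact hC (x, θ) ⟨hx, Ioc_subset_Icc_self hθ⟩
  · exact Filter.Eventually.of_forall fun θ _ x _ => hd x θ

/-! ### Polar coordinates -/

/-- The unit radial vector. -/
def ee (θ : ℝ) : (EuclideanSpace ℝ (Fin 2)) :=
  Real.cos θ • EuclideanSpace.single 0 (1 : ℝ) + Real.sin θ • EuclideanSpace.single 1 (1 : ℝ)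

/-- The unit angular vector. -/
def ff (θ : ℝ) : (EuclideanSpace ℝ (Fin 2)) :=
  (-Real.sin θ) • EuclideanSpace.single 0 (1 : ℝ) + Real.cos θ • EuclideanSpace.single 1 (1 : ℝ)

lemma ee_hasDerivAt (θ : ℝ) : HasDerivAt ee (ff θ) θ :=
  ((Real.hasDerivAt_cos θ).smul_const _).add ((Real.hasDerivAt_sin θ).smul_const _)

lemma ff_hasDerivAt (θ : ℝ) : HasDerivAt ff (-ee θ) θ := by
  have := ((Real.hasDerivAt_sin θ).neg.smul_const (EuclideanSpace.single 0 (1 : ℝ) : (EuclideanSpace ℝ (Fin 2)))).add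
    ((Real.hasDerivAt_cos θ).smul_const (EuclideanSpace.single 1 (1 : ℝ) : (EuclideanSpace ℝ (Fin 2))))
  refine this.congr_deriv ?_
  unfold ee
  module

lemma ee_norm (θ : ℝ) : ‖ee θ‖ = 1 := by
  rw [EuclideanSpace.norm_eq]
  simp [ee]

lemma ff_norm (θ : ℝ) : ‖ff θ‖ = 1 := by
  rw [EuclideanSpace.norm_eq]
  simp [ff]

lemma ee_continuous : Continuous ee := by
  unfold ee
  fun_prop

lemma ff_continuous : Continuous ff := by
  unfold ff
  fun_prop

lemma ee_pi : ee Real.pi = ee (-Real.pi) := by simp [ee]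

lemma ff_pi : ff Real.pi = ff (-Real.pi) := by simp [ff]

lemma exists_polar (x : (EuclideanSpace ℝ (Fin 2))) (hx : x ≠ 0) : ∃ s : ℝ, ∃ θ ∈ Icc (-Real.pi) Real.pi, x = Real.exp s • ee θ := by
  have hr : 0 < ‖x‖ := norm_pos_iff.2 hx
  set z : ℂ := ⟨x 0, x 1⟩ with hz
  have hnz : ‖z‖ = ‖x‖ := by
    rw [EuclideanSpace.norm_eq, Complex.norm_def, Complex.normSq_apply]
    simp [hz, sq]
  refine ⟨Real.log ‖x‖, Complex.arg z,
    ⟨(Complex.neg_pi_lt_arg z).le, Complex.arg_le_pi z⟩, ?_⟩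
  rw [Real.exp_log hr]
  ext i
  fin_cases i
  · have := Complex.norm_mul_cos_arg z
    rw [hnz] at this
    simp [ee, this]
    rfl
  · have := Complex.norm_mul_sin_arg z
    rw [hnz] at this
    simp [ee, this]
    rfl

/-- The map `(a, b) ↦ a e₀ + b e₁`. -/
def toE (q : ℝ × ℝ) : (EuclideanSpace ℝ (Fin 2)) := WithLp.toLp 2 ![q.1, q.2]

lemma toE_mp : MeasurePreserving toE := by
  have h1 := (volume_preserving_finTwoArrow ℝ).symm
  have h2 := PiLp.volume_preserving_toLp (Fin 2)
  exact h2.comp h1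

lemma toE_polar (r θ : ℝ) : toE (polarCoord.symm (r, θ)) = r • ee θ := by
  ext i
  fin_cases i <;> simp [toE, ee]

lemma energy_contra {f : (EuclideanSpace ℝ (Fin 2)) → ℝ} (hf : Continuous f) (hf0 : ∀ x, 0 ≤ f x) (hfi : Integrable f)
    {C R : ℝ} (hC : 0 < C) (hR : 0 ≤ R)
    (h : ∀ r, R < r → C ≤ r ^ 2 * ∫ θ in (-Real.pi)..Real.pi, f (r • ee θ)) : False := by
  have hpi := Real.pi_pos
  have htE : Measurable toE := toE_mp.measurable
  have h1 : Integrable (f ∘ toE) := toE_mp.integrable_comp_of_integrable hfi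
  have hcont : Continuous (fun q : ℝ × ℝ => q.1 * f (q.1 • ee q.2)) := by
    have := ee_continuous
    fun_prop
  have h2 : IntegrableOn (fun q : ℝ × ℝ => q.1 * f (q.1 • ee q.2)) polarCoord.target := by
    refine ⟨hcont.aestronglyMeasurable, ?_⟩
    have e := lintegral_comp_polarCoord_symm (fun q => ENNReal.ofReal ((f ∘ toE) q))
    have e2 : ∫⁻ q, ENNReal.ofReal ((f ∘ toE) q) < ⊤ := h1.lintegral_lt_top
    rw [← e] at e2
    rw [hasFiniteIntegral_iff_ofReal]
    · refine lt_of_le_of_lt (le_of_eq ?_) e2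
      refine setLIntegral_congr_fun polarCoord.open_target.measurableSet ?_
      intro q hq
      have hq1 : 0 < q.1 := hq.1
      have := toE_polar q.1 q.2
      simp only [Function.comp_apply]
      rw [this, ENNReal.ofReal_mul hq1.le, smul_eq_mul]
    · refine (ae_restrict_iff' polarCoord.open_target.measurableSet).2
        (Filter.Eventually.of_forall fun q hq => ?_)
      have hq1 : 0 < q.1 := hq.1
      exact mul_nonneg hq1.le (hf0 _)
  have h3 : Integrable (fun q : ℝ × ℝ => q.1 * f (q.1 • ee q.2))
      ((volume.restrict (Ioi (0 : ℝ))).prod (volume.restrict (Ioo (-Real.pi) Real.pi))) := by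
    rw [Measure.prod_restrict]
    exact h2
  have h4 := h3.integral_prod_left
  have h5 : IntegrableOn (fun r : ℝ => ∫ θ in Ioo (-Real.pi) Real.pi, r * f (r • ee θ)) (Ioi R) :=
    IntegrableOn.mono_set h4 (Ioi_subset_Ioi hR)
  have h6 : IntegrableOn (fun r : ℝ => C * r⁻¹) (Ioi R) := by
    refine Integrable.mono' h5 (by fun_prop) ?_
    refine (ae_restrict_iff' measurableSet_Ioi).2 (Filter.Eventually.of_forall fun r hr => ?_)
    have hr' : R < r := hr
    have hr0 : 0 < r := lt_of_le_of_lt hR hr'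
    have := h r hr
    rw [intervalIntegral.integral_of_le (by linarith), integral_Ioc_eq_integral_Ioo] at this
    rw [Real.norm_of_nonneg (by positivity), integral_const_mul]
    calc C * r⁻¹ ≤ (r ^ 2 * ∫ θ in Ioo (-Real.pi) Real.pi, f (r • ee θ)) * r⁻¹ := by gcongr
      _ = _ := by field_simp
  have h7 : IntegrableOn (fun r : ℝ => r⁻¹) (Ioi R) := by
    have := h6.const_mul C⁻¹
    refine this.congr (Filter.Eventually.of_forall fun r => ?_)
    simp only
    field_simp
  exact not_integrableOn_Ioi_inv h7

lemma fourier_unique {h : ℝ → ℝ} (hc : Continuous h) (hp : h (-Real.pi) = h Real.pi)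
    (h0 : ∫ θ in (-Real.pi)..Real.pi, h θ = 0)
    (hcos : ∀ n : ℕ, 1 ≤ n → ∫ θ in (-Real.pi)..Real.pi, h θ * Real.cos (n * θ) = 0)
    (hsin : ∀ n : ℕ, 1 ≤ n → ∫ θ in (-Real.pi)..Real.pi, h θ * Real.sin (n * θ) = 0) :
    ∀ θ ∈ Icc (-Real.pi) Real.pi, h θ = 0 := by
  have hpi := Real.pi_pos
  have : Fact (0 < 2 * Real.pi) := ⟨by positivity⟩
  have hcosZ : ∀ n : ℤ, ∫ θ in (-Real.pi)..Real.pi, h θ * Real.cos (n * θ) = 0 := by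
    intro n
    rcases Nat.eq_zero_or_pos n.natAbs with hn | hn
    · rw [Int.natAbs_eq_zero] at hn
      simpa [hn] using h0
    · have := hcos n.natAbs hn
      rcases Int.natAbs_eq n with e | e
      · rw [e]; simpa using this
      · rw [e]; simpa using this
  have hsinZ : ∀ n : ℤ, ∫ θ in (-Real.pi)..Real.pi, h θ * Real.sin (n * θ) = 0 := by
    intro n
    rcases Nat.eq_zero_or_pos n.natAbs with hn | hn
    · rw [Int.natAbs_eq_zero] at hn
      simp [hn]
    · have := hsin n.natAbs hn
      rcases Int.natAbs_eq n with e | e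
      · rw [e]; simpa using this
      · rw [e]; simpa using this
  have hend : -Real.pi + 2 * Real.pi = Real.pi := by ring
  set H : AddCircle (2 * Real.pi) → ℂ :=
    AddCircle.liftIco (2 * Real.pi) (-Real.pi) (fun θ => (h θ : ℂ)) with hH
  have hHc : Continuous H := by
    refine AddCircle.liftIco_continuous ?_ ?_
    · rw [hend, hp]
    · exact (Complex.continuous_ofReal.comp hc).continuousOn
  let Hc : C(AddCircle (2 * Real.pi), ℂ) := ⟨H, hHc⟩
  have hco : ∀ n : ℤ, fourierCoeff H n = 0 := by
    intro n
    rw [hH, fourierCoeff_liftIco_eq, fourierCoeffOn_eq_integral]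
    rw [hend]
    have : ∀ θ : ℝ, fourier (-n) (θ : AddCircle (Real.pi - -Real.pi)) • (h θ : ℂ) =
        ((h θ * Real.cos (n * θ) : ℝ) : ℂ) - ((h θ * Real.sin (n * θ) : ℝ) : ℂ) * Complex.I := by
      intro θ
      rw [fourier_coe_apply]
      have : (2 * (Real.pi : ℂ) * Complex.I * ((-n : ℤ) : ℂ) * (θ : ℂ) / ((Real.pi - -Real.pi : ℝ) : ℂ))
          = ((-(n * θ) : ℝ) : ℂ) * Complex.I := by
        have hp0 : (Real.pi : ℂ) ≠ 0 := by exact_mod_cast hpi.ne'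
        push_cast
        field_simp
        ring
      rw [this, Complex.exp_mul_I, ← Complex.ofReal_cos, ← Complex.ofReal_sin]
      rw [Real.cos_neg, Real.sin_neg]
      simp only [smul_eq_mul]
      push_cast
      ring
    simp_rw [this]
    rw [intervalIntegral.integral_sub, intervalIntegral.integral_mul_const,
      intervalIntegral.integral_ofReal, intervalIntegral.integral_ofReal, hcosZ, hsinZ]
    · simp
    · apply Continuous.intervalIntegrable
      fun_prop
    · apply Continuous.intervalIntegrable
      fun_prop
  have hco' : fourierCoeff Hc = 0 := funext hco
  have hs : Summable (fourierCoeff Hc) := by rw [hco']; exact summable_zero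
  have hsum := hasSum_fourier_series_of_summable hs
  rw [hco'] at hsum
  simp only [Pi.zero_apply, zero_smul] at hsum
  have hz : Hc = 0 := hsum.unique hasSum_zero
  suffices hI : ∀ θ ∈ Ico (-Real.pi) Real.pi, h θ = 0 by
    intro θ hθ
    rcases hθ.2.eq_or_lt with e | e
    · rw [e, ← hp]
      exact hI _ ⟨le_rfl, by linarith⟩
    · exact hI θ ⟨hθ.1, e⟩
  intro θ hθ
  have e1 : H (θ : AddCircle (2 * Real.pi)) = 0 := congrArg (fun g : C(AddCircle (2 * Real.pi), ℂ) => g θ) hz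
  rw [hH, AddCircle.liftIco_coe_apply (by rw [hend]; exact hθ)] at e1
  exact_mod_cast e1

/-! ### Fourier modes of a solution -/

lemma laplacian_eq {v : (EuclideanSpace ℝ (Fin 2)) → ℝ} (hv : ContDiff ℝ 2 v) (x : (EuclideanSpace ℝ (Fin 2))) :
    planeLaplacian v x =
      fderiv ℝ (fderiv ℝ v) x (EuclideanSpace.single 0 1) (EuclideanSpace.single 0 1) +
      fderiv ℝ (fderiv ℝ v) x (EuclideanSpace.single 1 1) (EuclideanSpace.single 1 1) := by
  have h1 : ∀ x, HasFDerivAt v (fderiv ℝ v x) x := fun x =>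
    (hv.differentiable (by norm_num) x).hasFDerivAt
  have hv1 : ContDiff ℝ 1 (fderiv ℝ v) := hv.fderiv_right (by norm_num)
  have h2 : ∀ x, HasFDerivAt (fderiv ℝ v) (fderiv ℝ (fderiv ℝ v) x) x := fun x =>
    (hv1.differentiable (by norm_num) x).hasFDerivAt
  have key : ∀ e : (EuclideanSpace ℝ (Fin 2)), deriv (deriv (fun t : ℝ => v (x + t • e))) 0 =
      fderiv ℝ (fderiv ℝ v) x e e := by
    intro e
    rw [deriv_line_of_contDiff h1]
    have h : HasDerivAt (fun t : ℝ => x + t • e) e 0 := by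
      simpa using ((hasDerivAt_id (0 : ℝ)).smul_const e).const_add x
    have h3 := (h2 (x + (0 : ℝ) • e)).comp_hasDerivAt 0 h
    have h4 := h3.clm_apply (hasDerivAt_const (0 : ℝ) e)
    refine Eq.trans (HasDerivAt.deriv h4) ?_
    simp
  unfold planeLaplacian
  rw [Fin.sum_univ_two, key, key]

lemma bilin_polar (B : (EuclideanSpace ℝ (Fin 2)) →L[ℝ] (EuclideanSpace ℝ (Fin 2)) →L[ℝ] ℝ) (θ : ℝ) :
    B (ee θ) (ee θ) + B (ff θ) (ff θ) =
      B (EuclideanSpace.single 0 1) (EuclideanSpace.single 0 1) +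
      B (EuclideanSpace.single 1 1) (EuclideanSpace.single 1 1) := by
  unfold ee ff
  simp only [map_add, map_smul, add_apply, smul_apply, smul_eq_mul]
  linear_combination (B (EuclideanSpace.single 0 1) (EuclideanSpace.single 0 1) +
      B (EuclideanSpace.single 1 1) (EuclideanSpace.single 1 1)) * Real.sin_sq_add_cos_sq θ

lemma xx_norm (s θ : ℝ) : ‖Real.exp s • ee θ‖ = Real.exp s := by
  rw [norm_smul, ee_norm, mul_one, Real.norm_of_nonneg (Real.exp_pos s).le]

/-- The angular derivative of `v` in logarithmic polar coordinates. -/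
lemma ang_deriv {v : (EuclideanSpace ℝ (Fin 2)) → ℝ} (hv : ContDiff ℝ 2 v) (s θ : ℝ) :
    HasDerivAt (fun θ => v (Real.exp s • ee θ))
      (fderiv ℝ v (Real.exp s • ee θ) (Real.exp s • ff θ)) θ := by
  have h1 := (hv.differentiable (by norm_num) (Real.exp s • ee θ)).hasFDerivAt
  exact h1.comp_hasDerivAt θ ((ee_hasDerivAt θ).const_smul (Real.exp s))

lemma ang_parts {v : (EuclideanSpace ℝ (Fin 2)) → ℝ} (hv : ContDiff ℝ 2 v) {n : ℝ} {g g' : ℝ → ℝ}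
    (hg' : ∀ θ, HasDerivAt g' (-n ^ 2 * g θ) θ) (hgc : Continuous g)
    (hper' : g' (-Real.pi) = g' Real.pi) (s : ℝ) :
    ∫ θ in (-Real.pi)..Real.pi, fderiv ℝ v (Real.exp s • ee θ) (Real.exp s • ff θ) * g' θ =
      n ^ 2 * ∫ θ in (-Real.pi)..Real.pi, v (Real.exp s • ee θ) * g θ := by
  have c1 := ee_continuous
  have c2 := ff_continuous
  have c3 : Continuous (fderiv ℝ v) := hv.continuous_fderiv (by norm_num)
  have := intervalIntegral.integral_deriv_mul_eq_sub (a := -Real.pi) (b := Real.pi)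
    (u := fun θ => v (Real.exp s • ee θ)) (v := g')
    (fun θ _ => ang_deriv hv s θ) (fun θ _ => hg' θ)
    (Continuous.intervalIntegrable (by fun_prop) _ _)
    (Continuous.intervalIntegrable (by fun_prop) _ _)
  rw [intervalIntegral.integral_add] at this
  · rw [← ee_pi, hper', sub_self] at this
    have e : ∫ θ in (-Real.pi)..Real.pi, v (Real.exp s • ee θ) * (-n ^ 2 * g θ) =
        -n ^ 2 * ∫ θ in (-Real.pi)..Real.pi, v (Real.exp s • ee θ) * g θ := by
      rw [← intervalIntegral.integral_const_mul]
      congr 1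
      ext θ
      ring
    rw [e] at this
    linarith
  · have c4 : Continuous g' := continuous_iff_continuousAt.2 fun θ => (hg' θ).continuousAt
    exact Continuous.intervalIntegrable (by fun_prop) _ _
  · have c5 := hv.continuous
    exact Continuous.intervalIntegrable (by fun_prop) _ _

lemma mode_formula {α : ℝ} {v : (EuclideanSpace ℝ (Fin 2)) → ℝ} (hv : ContDiff ℝ 2 v)
    (hpde : ∀ x : (EuclideanSpace ℝ (Fin 2)), planeLaplacian v x
          + 2 * (α + 2) ^ 2 * (‖x‖ ^ α / (1 + ‖x‖ ^ (2 + α)) ^ 2) * v x = 0)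
    {n : ℝ} (hn : 0 ≤ n) {g g' : ℝ → ℝ} (hg : ∀ θ, HasDerivAt g (g' θ) θ)
    (hg' : ∀ θ, HasDerivAt g' (-n ^ 2 * g θ) θ)
    (hper : g (-Real.pi) = g Real.pi) (hper' : g' (-Real.pi) = g' Real.pi)
    (hgb : ∀ θ, |g θ| ≤ 1) :
    ∃ q : ℝ, ∀ s, (((2 + α) / 2) ^ 2 - n ^ 2) *
      (∫ θ in (-Real.pi)..Real.pi, v (Real.exp s • ee θ) * g θ) =
      q * ((2 + α) / 2 * auxT (2 + α) s - n) * Real.exp (n * s) := by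
  have hpi := Real.pi_pos
  have c0 := hv.continuous
  have c1 := ee_continuous
  have c2 := ff_continuous
  have c3 : Continuous (fderiv ℝ v) := hv.continuous_fderiv (by norm_num)
  have hv1 : ContDiff ℝ 1 (fderiv ℝ v) := hv.fderiv_right (by norm_num)
  have c4 : Continuous (fderiv ℝ (fderiv ℝ v)) := hv1.continuous_fderiv (by norm_num)
  have cg : Continuous g := continuous_iff_continuousAt.2 fun θ => (hg θ).continuousAt
  have cg' : Continuous g' := continuous_iff_continuousAt.2 fun θ => (hg' θ).continuousAt
  have d1 : ∀ x, HasFDerivAt v (fderiv ℝ v x) x := fun x =>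
    (hv.differentiable (by norm_num) x).hasFDerivAt
  have d2 : ∀ x, HasFDerivAt (fderiv ℝ v) (fderiv ℝ (fderiv ℝ v) x) x := fun x =>
    (hv1.differentiable (by norm_num) x).hasFDerivAt
  have dx : ∀ s θ, HasDerivAt (fun s => Real.exp s • ee θ) (Real.exp s • ee θ) s := fun s θ =>
    (Real.hasDerivAt_exp s).smul_const _
  have dy : ∀ s θ, HasDerivAt (fun θ => Real.exp s • ee θ) (Real.exp s • ff θ) θ := fun s θ =>
    (ee_hasDerivAt θ).const_smul (Real.exp s)
  have dy2 : ∀ s θ, HasDerivAt (fun θ => Real.exp s • ff θ) (-(Real.exp s • ee θ)) θ := fun s θ => by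
    have := (ff_hasDerivAt θ).const_smul (Real.exp s)
    rwa [smul_neg] at this
  set X : ℝ → ℝ → (EuclideanSpace ℝ (Fin 2)) := fun s θ => Real.exp s • ee θ with hX
  set Y : ℝ → ℝ → (EuclideanSpace ℝ (Fin 2)) := fun s θ => Real.exp s • ff θ with hY
  set F1 : ℝ → ℝ → ℝ := fun s θ => fderiv ℝ v (X s θ) (X s θ) with hF1
  set F2 : ℝ → ℝ → ℝ := fun s θ => fderiv ℝ (fderiv ℝ v) (X s θ) (X s θ) (X s θ) +
    fderiv ℝ v (X s θ) (X s θ) with hF2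
  set G1 : ℝ → ℝ → ℝ := fun s θ => fderiv ℝ v (X s θ) (Y s θ) with hG1
  set G2 : ℝ → ℝ → ℝ := fun s θ => fderiv ℝ (fderiv ℝ v) (X s θ) (Y s θ) (Y s θ) -
    fderiv ℝ v (X s θ) (X s θ) with hG2
  have dF : ∀ s θ, HasDerivAt (fun s => v (X s θ)) (F1 s θ) s := fun s θ =>
    (d1 _).comp_hasDerivAt s (dx s θ)
  have dF1 : ∀ s θ, HasDerivAt (fun s => F1 s θ) (F2 s θ) s := fun s θ =>
    ((d2 _).comp_hasDerivAt s (dx s θ)).clm_apply (dx s θ)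
  have dG1 : ∀ s θ, HasDerivAt (fun θ => G1 s θ) (G2 s θ) θ := fun s θ => by
    refine (((d2 _).comp_hasDerivAt θ (dy s θ)).clm_apply (dy2 s θ)).congr_deriv ?_
    simp only [hG2, hX, hY, Function.comp, map_neg]
    ring
  have hsum : ∀ s θ, F2 s θ + G2 s θ =
      -(2 * ((2 + α) / 2) ^ 2 * (1 - auxT (2 + α) s ^ 2)) * v (X s θ) := by
    intro s θ
    have e1 := bilin_polar (fderiv ℝ (fderiv ℝ v) (X s θ)) θ
    rw [← laplacian_eq hv] at e1
    have e2 := hpde (X s θ)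
    have e3 : F2 s θ + G2 s θ = Real.exp s ^ 2 * planeLaplacian v (X s θ) := by
      rw [← e1]
      simp only [hF2, hG2]
      have : ∀ B : (EuclideanSpace ℝ (Fin 2)) →L[ℝ] (EuclideanSpace ℝ (Fin 2)) →L[ℝ] ℝ, B (X s θ) (X s θ) + B (Y s θ) (Y s θ) =
          Real.exp s ^ 2 * (B (ee θ) (ee θ) + B (ff θ) (ff θ)) := by
        intro B
        simp only [hX, hY, map_smul, smul_apply, smul_eq_mul]
        ring
      rw [← this]
      ring
    rw [e3]
    have e4 : planeLaplacian v (X s θ) = -(2 * (α + 2) ^ 2 *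
      (‖X s θ‖ ^ α / (1 + ‖X s θ‖ ^ (2 + α)) ^ 2) * v (X s θ)) := by linarith
    rw [e4]
    have e5 : ‖X s θ‖ = Real.exp s := xx_norm s θ
    have e6 : Real.exp s ^ (2 + α) = Real.exp ((2 + α) * s) := by
      rw [← Real.exp_mul, mul_comm]
    have e7 : Real.exp s ^ 2 * Real.exp s ^ α = Real.exp ((2 + α) * s) := by
      rw [← e6, Real.rpow_add (Real.exp_pos s), Real.rpow_two]
    rw [e5, e6]
    have e8 : 1 - auxT (2 + α) s ^ 2 =
        4 * Real.exp ((2 + α) * s) / (1 + Real.exp ((2 + α) * s)) ^ 2 := by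
      unfold auxT
      have : Real.exp ((2 + α) * s) + 1 ≠ 0 := by positivity
      have : 1 + Real.exp ((2 + α) * s) ≠ 0 := by positivity
      field_simp
      ring
    rw [e8, ← e7]
    ring
  have hP1 : ∀ s, HasDerivAt (fun s => ∫ θ in (-Real.pi)..Real.pi, v (X s θ) * g θ)
      (∫ θ in (-Real.pi)..Real.pi, F1 s θ * g θ) s :=
    param_deriv (G := fun s θ => v (X s θ) * g θ) (G' := fun s θ => F1 s θ * g θ)
      (by simp only [Function.uncurry_def, hX]; fun_prop)
      (by simp only [Function.uncurry_def, hF1, hX]; fun_prop)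
      (fun s θ => (dF s θ).mul_const _)
  have hP2 : ∀ s, HasDerivAt (fun s => ∫ θ in (-Real.pi)..Real.pi, F1 s θ * g θ)
      (∫ θ in (-Real.pi)..Real.pi, F2 s θ * g θ) s :=
    param_deriv (G := fun s θ => F1 s θ * g θ) (G' := fun s θ => F2 s θ * g θ)
      (by simp only [Function.uncurry_def, hF1, hX]; fun_prop)
      (by simp only [Function.uncurry_def, hF2, hX]; fun_prop)
      (fun s θ => (dF1 s θ).mul_const _)
  obtain ⟨M0, hM0⟩ := (isCompact_closedBall (0 : (EuclideanSpace ℝ (Fin 2))) 1).exists_bound_of_continuousOn c0.continuousOn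
  obtain ⟨M1, hM1⟩ := (isCompact_closedBall (0 : (EuclideanSpace ℝ (Fin 2))) 1).exists_bound_of_continuousOn c3.continuousOn
  have hXb : ∀ s ≤ 0, ∀ θ, ‖X s θ‖ ≤ 1 := by
    intro s hs θ
    rw [hX]
    simp only [xx_norm]
    exact Real.exp_le_one_iff.2 hs
  have hM1' : 0 ≤ M1 := (norm_nonneg _).trans (hM1 0 (by simp))
  have hM0' : 0 ≤ M0 := (norm_nonneg _).trans (hM0 0 (by simp))
  refine ode_main (M := (M0 + M1) * (2 * Real.pi)) hn hP1 hP2 ?_ ?_ ?_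
  · intro s
    have i1 : ∫ θ in (-Real.pi)..Real.pi, G1 s θ * g' θ =
        n ^ 2 * ∫ θ in (-Real.pi)..Real.pi, v (X s θ) * g θ := ang_parts hv hg' cg hper' s
    have i2 := intervalIntegral.integral_deriv_mul_eq_sub (a := -Real.pi)
      (b := Real.pi) (u := G1 s) (v := g) (fun θ _ => dG1 s θ) (fun θ _ => hg θ)
      (Continuous.intervalIntegrable (by simp only [hG2, hX, hY]; fun_prop) _ _)
      (Continuous.intervalIntegrable (by fun_prop) _ _)
    have i3 : G1 s Real.pi = G1 s (-Real.pi) := by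
      simp only [hG1, hX, hY, ee_pi, ff_pi]
    rw [intervalIntegral.integral_add, i1, i3, hper, sub_self] at i2
    · have i4 : ∫ θ in (-Real.pi)..Real.pi, F2 s θ * g θ =
          (∫ θ in (-Real.pi)..Real.pi, -(2 * ((2 + α) / 2) ^ 2 * (1 - auxT (2 + α) s ^ 2)) *
            (v (X s θ) * g θ)) - ∫ θ in (-Real.pi)..Real.pi, G2 s θ * g θ := by
        rw [← intervalIntegral.integral_sub]
        · congr 1
          ext θ
          linear_combination g θ * hsum s θ
        · exact Continuous.intervalIntegrable (by simp only [hX]; fun_prop) _ _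
        · exact Continuous.intervalIntegrable (by simp only [hG2, hX, hY]; fun_prop) _ _
      rw [i4, intervalIntegral.integral_const_mul]
      linarith
    · exact Continuous.intervalIntegrable (by simp only [hG2, hX, hY]; fun_prop) _ _
    · exact Continuous.intervalIntegrable (by simp only [hG1, hX, hY]; fun_prop) _ _
  · intro s hs
    have := intervalIntegral.norm_integral_le_of_norm_le_const (a := -Real.pi) (b := Real.pi)
      (f := fun θ => v (X s θ) * g θ) (C := M0 + M1) ?_
    · rw [Real.norm_eq_abs] at this
      refine this.trans (le_of_eq ?_)
      rw [abs_of_pos (by linarith)]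
      ring
    · intro θ _
      have e1 := hM0 (X s θ) (by simpa using hXb s hs θ)
      rw [norm_mul]
      have e2 := hgb θ
      calc ‖v (X s θ)‖ * ‖g θ‖ ≤ M0 * 1 := by
            rw [Real.norm_eq_abs (g θ)]; gcongr
        _ ≤ _ := by linarith
  · intro s hs
    have := intervalIntegral.norm_integral_le_of_norm_le_const (a := -Real.pi) (b := Real.pi)
      (f := fun θ => F1 s θ * g θ) (C := M0 + M1) ?_
    · rw [Real.norm_eq_abs] at this
      refine this.trans (le_of_eq ?_)
      rw [abs_of_pos (by linarith)]
      ring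
    · intro θ _
      have e1 := hM1 (X s θ) (by simpa using hXb s hs θ)
      rw [norm_mul]
      have e2 := hgb θ
      have e3 : ‖F1 s θ‖ ≤ M1 * 1 := by
        refine (ContinuousLinearMap.le_opNorm _ _).trans ?_
        have := hXb s hs θ
        gcongr
      calc ‖F1 s θ‖ * ‖g θ‖ ≤ (M1 * 1) * 1 := by
            rw [Real.norm_eq_abs (g θ)]; gcongr
        _ ≤ _ := by linarith

lemma mode_zero {α : ℝ} (hα : 0 < α) {v : (EuclideanSpace ℝ (Fin 2)) → ℝ} (hv : ContDiff ℝ 2 v)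
    (hpde : ∀ x : (EuclideanSpace ℝ (Fin 2)), planeLaplacian v x
          + 2 * (α + 2) ^ 2 * (‖x‖ ^ α / (1 + ‖x‖ ^ (2 + α)) ^ 2) * v x = 0)
    (hEn : Integrable (fun x : (EuclideanSpace ℝ (Fin 2)) => ‖fderiv ℝ v x‖ ^ 2))
    {n : ℝ} (hn : 1 ≤ n) (hne : n ≠ (2 + α) / 2) {g g' : ℝ → ℝ} (hg : ∀ θ, HasDerivAt g (g' θ) θ)
    (hg' : ∀ θ, HasDerivAt g' (-n ^ 2 * g θ) θ)
    (hper : g (-Real.pi) = g Real.pi) (hper' : g' (-Real.pi) = g' Real.pi)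
    (hgb : ∀ θ, |g θ| ≤ 1) (hgb' : ∀ θ, |g' θ| ≤ n) (s : ℝ) :
    ∫ θ in (-Real.pi)..Real.pi, v (Real.exp s • ee θ) * g θ = 0 := by
  have hpi := Real.pi_pos
  have c0 := hv.continuous
  have c1 := ee_continuous
  have c2 := ff_continuous
  have c3 : Continuous (fderiv ℝ v) := hv.continuous_fderiv (by norm_num)
  have cg : Continuous g := continuous_iff_continuousAt.2 fun θ => (hg θ).continuousAt
  have cg' : Continuous g' := continuous_iff_continuousAt.2 fun θ => (hg' θ).continuousAt
  obtain ⟨q, hq⟩ := mode_formula hv hpde (by linarith) hg hg' hper hper' hgb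
  set b := (2 + α) / 2 with hb
  have hb0 : 0 < b := by rw [hb]; positivity
  have hbn : b ^ 2 - n ^ 2 ≠ 0 := by
    have : b ^ 2 - n ^ 2 = (b - n) * (b + n) := by ring
    rw [this]
    refine mul_ne_zero (sub_ne_zero.2 hne.symm) ?_
    linarith
  set P : ℝ → ℝ := fun s => ∫ θ in (-Real.pi)..Real.pi, v (Real.exp s • ee θ) * g θ with hP
  have hq0 : q = 0 := by
    by_contra hqne
    have t1 : Filter.Tendsto (fun s => |q * (b * auxT (2 + α) s - n)| / |b ^ 2 - n ^ 2|) Filter.atTop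
        (nhds (|q * (b * 1 - n)| / |b ^ 2 - n ^ 2|)) :=
      (((((auxT_tendsto (by linarith : 0 < 2 + α)).const_mul b).sub_const n).const_mul q).abs).div_const _
    have t2 : 0 < |q * (b * 1 - n)| / |b ^ 2 - n ^ 2| := by
      have : b * 1 - n ≠ 0 := by rw [mul_one]; exact sub_ne_zero.2 hne.symm
      positivity
    have t3 : Filter.Tendsto (fun s => Real.exp (n * s)) Filter.atTop Filter.atTop :=
      Real.tendsto_exp_atTop.comp (Filter.tendsto_id.const_mul_atTop (by linarith))
    have t4 := t1.pos_mul_atTop t2 t3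
    obtain ⟨S, hS⟩ := (t4.eventually_ge_atTop (2 * Real.pi + 1)).exists_forall_of_atTop
    refine energy_contra (f := fun x => ‖fderiv ℝ v x‖ ^ 2) (by fun_prop) (fun x => by positivity)
      hEn (C := 1) (R := Real.exp S) one_pos (Real.exp_pos S).le ?_
    intro r hr
    have hr0 : 0 < r := (Real.exp_pos S).trans hr
    obtain ⟨s, rfl⟩ : ∃ s, r = Real.exp s := ⟨Real.log r, (Real.exp_log hr0).symm⟩
    have hs := hS s (Real.exp_le_exp.1 hr.le)
    have e1 : |P s| = |q * (b * auxT (2 + α) s - n)| / |b ^ 2 - n ^ 2| * Real.exp (n * s) := by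
      have := congrArg abs (hq s)
      rw [abs_mul, abs_mul, abs_of_pos (Real.exp_pos (n * s))] at this
      have h3 : |b ^ 2 - n ^ 2| ≠ 0 := abs_ne_zero.2 hbn
      field_simp
      linarith
    rw [← e1] at hs
    have e2 := ang_parts hv hg' cg hper' s
    have e3 : n ^ 2 * |P s| ≤ ∫ θ in (-Real.pi)..Real.pi,
        n * (Real.exp s ^ 2 * ‖fderiv ℝ v (Real.exp s • ee θ)‖ ^ 2 + 1) := by
      have : n ^ 2 * |P s| = |n ^ 2 * P s| := by rw [abs_mul, abs_of_nonneg (sq_nonneg n)]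
      rw [this, ← e2]
      refine (intervalIntegral.abs_integral_le_integral_abs (by linarith)).trans ?_
      refine intervalIntegral.integral_mono_on (by linarith)
        (Continuous.intervalIntegrable (by fun_prop) _ _)
        (Continuous.intervalIntegrable (by fun_prop) _ _) ?_
      intro θ _
      rw [abs_mul]
      have f1 : |fderiv ℝ v (Real.exp s • ee θ) (Real.exp s • ff θ)| ≤
          ‖fderiv ℝ v (Real.exp s • ee θ)‖ * Real.exp s := by
        refine ((fderiv ℝ v (Real.exp s • ee θ)).le_opNorm (Real.exp s • ff θ)).trans ?_
        rw [norm_smul, ff_norm, mul_one, Real.norm_of_nonneg (Real.exp_pos s).le]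
      have f2 := hgb' θ
      have f3 : ‖fderiv ℝ v (Real.exp s • ee θ)‖ * Real.exp s ≤
          Real.exp s ^ 2 * ‖fderiv ℝ v (Real.exp s • ee θ)‖ ^ 2 + 1 := by
        nlinarith [sq_nonneg (‖fderiv ℝ v (Real.exp s • ee θ)‖ * Real.exp s - 1),
          sq_nonneg (‖fderiv ℝ v (Real.exp s • ee θ)‖ * Real.exp s)]
      calc _ ≤ (Real.exp s ^ 2 * ‖fderiv ℝ v (Real.exp s • ee θ)‖ ^ 2 + 1) * n := by
            gcongr
            exact f1.trans f3
        _ = _ := by ring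
    rw [intervalIntegral.integral_const_mul, intervalIntegral.integral_add,
      intervalIntegral.integral_const_mul] at e3
    · simp only [intervalIntegral.integral_const, smul_eq_mul, mul_one] at e3
      set I := ∫ θ in (-Real.pi)..Real.pi, ‖fderiv ℝ v (Real.exp s • ee θ)‖ ^ 2
      have e4 : n * |P s| ≤ Real.exp s ^ 2 * I + (Real.pi - -Real.pi) := by
        have : n * (n * |P s|) ≤ n * (Real.exp s ^ 2 * I + (Real.pi - -Real.pi)) := by linarith
        exact le_of_mul_le_mul_left this (by linarith)
      have e5 : |P s| ≤ n * |P s| := le_mul_of_one_le_left (abs_nonneg _) hn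
      change 1 ≤ Real.exp s ^ 2 * I
      linarith
    · exact Continuous.intervalIntegrable (by fun_prop) _ _
    · exact Continuous.intervalIntegrable (by fun_prop) _ _
  have := hq s
  rw [hq0, zero_mul, zero_mul] at this
  exact (mul_eq_zero.1 this).resolve_left hbn

lemma forward {α : ℝ} (hα : 0 < α) (hne : ∀ k : ℕ, 1 ≤ k → α ≠ 2 * ((k : ℝ) - 1))
    {v : (EuclideanSpace ℝ (Fin 2)) → ℝ} (hv : ContDiff ℝ 2 v)
    (hpde : ∀ x : (EuclideanSpace ℝ (Fin 2)), planeLaplacian v x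
          + 2 * (α + 2) ^ 2 * (‖x‖ ^ α / (1 + ‖x‖ ^ (2 + α)) ^ 2) * v x = 0)
    (hEn : Integrable (fun x : (EuclideanSpace ℝ (Fin 2)) => ‖fderiv ℝ v x‖ ^ 2)) :
    ∃ c : ℝ, ∀ x : (EuclideanSpace ℝ (Fin 2)), v x = c * (1 - ‖x‖ ^ (2 + α)) / (1 + ‖x‖ ^ (2 + α)) := by
  have hpi := Real.pi_pos
  have c0 := hv.continuous
  have c1 := ee_continuous
  obtain ⟨q, hq⟩ := mode_formula hv hpde (n := 0) le_rfl (g := fun _ => 1) (g' := fun _ => 0)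
    (fun θ => hasDerivAt_const θ 1) (fun θ => by simpa using hasDerivAt_const θ (0 : ℝ)) rfl rfl
    (by simp)
  simp only [mul_one, zero_mul, Real.exp_zero, sub_zero, ne_eq, OfNat.ofNat_ne_zero,
    not_false_eq_true, zero_pow] at hq
  set c : ℝ := -(q / ((2 + α) / 2) / (2 * Real.pi)) with hc
  refine ⟨c, ?_⟩
  have hsin_int : ∀ n : ℕ, Real.sin (n * Real.pi) = 0 := Real.sin_nat_mul_pi
  have lin : ∀ (n : ℕ) (θ : ℝ), HasDerivAt (fun θ : ℝ => (n : ℝ) * θ) n θ := fun n θ => by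
    simpa using (hasDerivAt_id θ).const_mul (n : ℝ)
  have key : ∀ s, ∀ θ ∈ Icc (-Real.pi) Real.pi, v (Real.exp s • ee θ) - (-c * auxT (2 + α) s) = 0 := by
    intro s
    have hnb : ∀ n : ℕ, 1 ≤ n → (n : ℝ) ≠ (2 + α) / 2 := by
      intro n hn h
      exact hne n hn (by linarith)
    have icos : ∀ n : ℕ, 1 ≤ n → ∫ θ in (-Real.pi)..Real.pi, Real.cos (n * θ) = 0 := by
      intro n hn
      have hn0 : (n : ℝ) ≠ 0 := by positivity
      rw [intervalIntegral.integral_comp_mul_left _ hn0, integral_cos]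
      simp
    have isin : ∀ n : ℕ, 1 ≤ n → ∫ θ in (-Real.pi)..Real.pi, Real.sin (n * θ) = 0 := by
      intro n hn
      have hn0 : (n : ℝ) ≠ 0 := by positivity
      rw [intervalIntegral.integral_comp_mul_left _ hn0, integral_sin]
      simp
    refine fourier_unique (by fun_prop) (by rw [ee_pi]) ?_ ?_ ?_
    · rw [intervalIntegral.integral_sub (Continuous.intervalIntegrable (by fun_prop) _ _)
        (Continuous.intervalIntegrable (by fun_prop) _ _)]
      have h1 := hq s
      have h2 : ((2 + α) / 2) ≠ 0 := by positivity
      simp only [intervalIntegral.integral_const, smul_eq_mul]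
      have h3 : ∫ θ in (-Real.pi)..Real.pi, v (Real.exp s • ee θ) =
          q / ((2 + α) / 2) * auxT (2 + α) s := by
        have : ((2 + α) / 2) ^ 2 * (∫ θ in (-Real.pi)..Real.pi, v (Real.exp s • ee θ)) =
          ((2 + α) / 2) ^ 2 * (q / ((2 + α) / 2) * auxT (2 + α) s) := by
            rw [h1]; field_simp
        exact mul_left_cancel₀ (pow_ne_zero 2 h2) this
      rw [h3, hc]
      field_simp
      ring
    · intro n hn
      have hn1 : (1 : ℝ) ≤ n := by exact_mod_cast hn
      have := mode_zero hα hv hpde hEn hn1 (hnb n hn)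
        (g := fun θ => Real.cos (n * θ)) (g' := fun θ => -Real.sin (n * θ) * n)
        (fun θ => (lin n θ).cos)
        (fun θ => by
          refine ((lin n θ).sin.neg.mul_const (n : ℝ)).congr_deriv ?_
          ring)
        (by simp) (by simp)
        (fun θ => Real.abs_cos_le_one _)
        (fun θ => by
          rw [abs_mul, abs_neg, abs_of_nonneg (by positivity : (0 : ℝ) ≤ n)]
          exact mul_le_of_le_one_left (by positivity) (Real.abs_sin_le_one _)) s
      simp_rw [sub_mul]
      rw [intervalIntegral.integral_sub (Continuous.intervalIntegrable (by fun_prop) _ _)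
        (Continuous.intervalIntegrable (by fun_prop) _ _), this,
        intervalIntegral.integral_const_mul, icos n hn]
      simp
    · intro n hn
      have hn1 : (1 : ℝ) ≤ n := by exact_mod_cast hn
      have := mode_zero hα hv hpde hEn hn1 (hnb n hn)
        (g := fun θ => Real.sin (n * θ)) (g' := fun θ => Real.cos (n * θ) * n)
        (fun θ => (lin n θ).sin)
        (fun θ => by
          refine ((lin n θ).cos.mul_const (n : ℝ)).congr_deriv ?_
          ring)
        (by simp) (by simp)
        (fun θ => Real.abs_sin_le_one _)
        (fun θ => by
          rw [abs_mul, abs_of_nonneg (by positivity : (0 : ℝ) ≤ n)]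
          exact mul_le_of_le_one_left (by positivity) (Real.abs_cos_le_one _)) s
      simp_rw [sub_mul]
      rw [intervalIntegral.integral_sub (Continuous.intervalIntegrable (by fun_prop) _ _)
        (Continuous.intervalIntegrable (by fun_prop) _ _), this,
        intervalIntegral.integral_const_mul, isin n hn]
      simp
  have hEq : v = fun x : (EuclideanSpace ℝ (Fin 2)) => c * (1 - ‖x‖ ^ (2 + α)) / (1 + ‖x‖ ^ (2 + α)) := by
    refine Continuous.ext_on (dense_compl_singleton (0 : (EuclideanSpace ℝ (Fin 2)))) c0 (auxphi_contDiff hα c).continuous ?_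
    intro x hx
    obtain ⟨s, θ, hθ, rfl⟩ := exists_polar x hx
    have h1 := key s θ hθ
    simp only [xx_norm]
    have e6 : Real.exp s ^ (2 + α) = Real.exp ((2 + α) * s) := by
      rw [← Real.exp_mul, mul_comm]
    rw [e6, sub_eq_zero.1 h1]
    unfold auxT
    have : Real.exp ((2 + α) * s) + 1 ≠ 0 := by positivity
    rw [add_comm (1 : ℝ)]
    field_simp
    ring
  exact fun x => congrFun hEq x

/-- for `α > 0` not an even integer, the space of finite-Dirichlet-energy
solutions of the linearized equation
`Δv + 2(α+2)² |x|^α/(1+|x|^{2+α})² v = 0` in `ℝ²` is one-dimensional, spanned by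
`(1 − |x|^{2+α})/(1 + |x|^{2+α})`; conversely every multiple of this function is such
a solution. -/
theorem stmt_15 (α : ℝ) (hα : 0 < α)
    (hne : ∀ k : ℕ, 1 ≤ k → α ≠ 2 * ((k : ℝ) - 1)) :
    (∀ v : EuclideanSpace ℝ (Fin 2) → ℝ, ContDiff ℝ 2 v →
      (∀ x : EuclideanSpace ℝ (Fin 2),
        planeLaplacian v x
          + 2 * (α + 2) ^ 2 * (‖x‖ ^ α / (1 + ‖x‖ ^ (2 + α)) ^ 2) * v x = 0) →
      Integrable (fun x : EuclideanSpace ℝ (Fin 2) => ‖fderiv ℝ v x‖ ^ 2) →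
      ∃ c : ℝ, ∀ x : EuclideanSpace ℝ (Fin 2),
        v x = c * (1 - ‖x‖ ^ (2 + α)) / (1 + ‖x‖ ^ (2 + α))) ∧
    (∀ c : ℝ,
      ContDiff ℝ 2 (fun x : EuclideanSpace ℝ (Fin 2) =>
        c * (1 - ‖x‖ ^ (2 + α)) / (1 + ‖x‖ ^ (2 + α))) ∧
      (∀ x : EuclideanSpace ℝ (Fin 2),
        planeLaplacian (fun y => c * (1 - ‖y‖ ^ (2 + α)) / (1 + ‖y‖ ^ (2 + α))) x
          + 2 * (α + 2) ^ 2 * (‖x‖ ^ α / (1 + ‖x‖ ^ (2 + α)) ^ 2) *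
            (c * (1 - ‖x‖ ^ (2 + α)) / (1 + ‖x‖ ^ (2 + α))) = 0) ∧
      Integrable (fun x : EuclideanSpace ℝ (Fin 2) =>
        ‖fderiv ℝ (fun y => c * (1 - ‖y‖ ^ (2 + α)) / (1 + ‖y‖ ^ (2 + α))) x‖ ^ 2)) := by
  refine ⟨fun v hv hpde hEn => forward hα hne hv hpde hEn, fun c => ?_⟩
  exact ⟨auxphi_contDiff hα c, auxphi_laplacian hα c, auxphi_integrable hα c⟩

end
end
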